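/- (Weyl–von Neumann–Berg theorem for quaternionic operators.) Let T ∈ C(H) be a densely defined closed right linear normal operator in the separable quaternionic Hilbert space H = ℓ²(ℕ, ℍ). Then for every ε > 0 there exist a compact operator K ∈ B(H) with ‖K‖ < ε and a diagonal operator D in H with D(D) = D(T) such that T = D + K, i.e., Tx = Dx + Kx for all x ∈ D(T). -/

import Mathlib

noncomputable section

open Quaternion Filter Topology

/-- The division ring `ℍ` of real quaternions. -/
abbrev Hq := Quaternion ℝ

/-- The quaternionic Hilbert space `H = ℓ²(ℕ, ℍ)`. -/
abbrev Hsp := lp (fun _ : ℕ => Hq) 2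

/-- Right scalar multiplication `x ↦ x · q` on `ℓ²(ℕ, ℍ)` (coordinatewise right
multiplication by the quaternion `q`). -/
def rsmul (q : Hq) (x : Hsp) : Hsp := MulOpposite.op q • x

/-- The quaternionic inner product `⟨x, y⟩ = ∑ₙ x̄ₙ yₙ`. -/
def qinner (x y : Hsp) : Hq := ∑' n, star (x n) * y n

/-- The set `𝕊` of unit imaginary quaternions. -/
def QS : Set Hq := {q | star q = -q ∧ ‖q‖ = 1}

/-- The slice complex plane `ℂ_m = {α + mβ : α, β ∈ ℝ}`. -/
def sliceC (m : Hq) : Set Hq := {q | ∃ α β : ℝ, q = (α : Hq) + m * (β : Hq)}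

/-- The closed upper half slice plane `ℂ_m⁺ = {α + mβ : α ∈ ℝ, β ≥ 0}`. -/
def sliceCplus (m : Hq) : Set Hq :=
  {q | ∃ α β : ℝ, 0 ≤ β ∧ q = (α : Hq) + m * (β : Hq)}

/-- `T : H → H` is a bounded right linear operator, i.e. `T ∈ B(H)`. -/
def IsBoundedRightLinear (T : Hsp → Hsp) : Prop :=
  (∀ x y, T (x + y) = T x + T y) ∧ (∀ q x, T (rsmul q x) = rsmul q (T x)) ∧
    ∃ M : ℝ, ∀ x, ‖T x‖ ≤ M * ‖x‖

/-- `S` is the adjoint of the (bounded) operator `T`: `⟨y, Tx⟩ = ⟨Sy, x⟩` for all `x, y`. -/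
def AdjointOf (T S : Hsp → Hsp) : Prop := ∀ x y, qinner y (T x) = qinner (S y) x

/-- `T` is anti self-adjoint: `T* = -T`. -/
def IsAntiSelfAdjoint (T : Hsp → Hsp) : Prop := AdjointOf T (fun x => -(T x))

/-- `T` is unitary: `T*T = TT* = I`. -/
def IsUnitaryOp (T : Hsp → Hsp) : Prop :=
  ∃ S, AdjointOf T S ∧ (∀ x, S (T x) = x) ∧ (∀ x, T (S x) = x)

/-- The slice Hilbert space `H₊^{Jm} = {u ∈ H : Ju = um}`. -/
def Hplus (J : Hsp → Hsp) (m : Hq) : Set Hsp := {u | J u = rsmul m u}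

/-- `H₋^{Jm} = {u ∈ H : Ju = -um}`. -/
def Hminus (J : Hsp → Hsp) (m : Hq) : Set Hsp := {u | J u = -(rsmul m u)}

/-- `e` is an orthonormal basis of the (closed subspace given by the) set `S`:
each `e r` lies in `S`, the `e r` are orthonormal, and every `x ∈ S` expands as
`x = ∑ᵣ (e r) ⟨e r, x⟩`. Taking `S = Set.univ` gives orthonormal bases of `H`. -/
def IsONBasisOn (S : Set Hsp) (e : ℕ → Hsp) : Prop :=
  (∀ r, e r ∈ S) ∧ (∀ r s, qinner (e r) (e s) = if r = s then 1 else 0) ∧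
    ∀ x ∈ S, HasSum (fun r => rsmul (qinner (e r) x) (e r)) x

/-- A (possibly unbounded) operator in `H`: a domain together with an assignment of
values (only the values on the domain are relevant). -/
structure QOp where
  dom : Set Hsp
  app : Hsp → Hsp

/-- The operator `T` is right linear: its domain is a right `ℍ`-submodule and `T`
is additive and right `ℍ`-homogeneous on it. -/
def QOp.IsRightLinear (T : QOp) : Prop :=
  (0 ∈ T.dom) ∧
  (∀ x ∈ T.dom, ∀ y ∈ T.dom, x + y ∈ T.dom ∧ T.app (x + y) = T.app x + T.app y) ∧
  (∀ x ∈ T.dom, ∀ q : Hq, rsmul q x ∈ T.dom ∧ T.app (rsmul q x) = rsmul q (T.app x))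

/-- `T` is densely defined. -/
def QOp.IsDenselyDefined (T : QOp) : Prop := Dense T.dom

/-- `T` is a closed operator: its graph is closed in `H × H`. -/
def QOp.IsClosedOp (T : QOp) : Prop :=
  IsClosed {p : Hsp × Hsp | p.1 ∈ T.dom ∧ p.2 = T.app p.1}

/-- `S` is the adjoint `T*` of `T`: the domain of `S` is
`{y : x ↦ ⟨y, Tx⟩ is continuous on D(T)}` and `⟨y, Tx⟩ = ⟨Sy, x⟩` there. -/
def QOp.IsAdjointOf (T S : QOp) : Prop :=
  S.dom = {y | ContinuousOn (fun x => qinner y (T.app x)) T.dom} ∧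
  ∀ y ∈ S.dom, ∀ x ∈ T.dom, qinner y (T.app x) = qinner (S.app y) x

/-- Composition `S ∘ T` of partial operators, with the natural domain. -/
def QOp.comp (S T : QOp) : QOp :=
  ⟨{x ∈ T.dom | T.app x ∈ S.dom}, fun x => S.app (T.app x)⟩

/-- Equality of partial operators: equal domains and equal values on the domain. -/
def QOp.Eq (A B : QOp) : Prop := A.dom = B.dom ∧ ∀ x ∈ A.dom, A.app x = B.app x

/-- `T` is normal: `T*T = TT*` (including equality of the domains). -/
def QOp.IsNormal (T : QOp) : Prop :=
  ∃ S : QOp, T.IsAdjointOf S ∧ QOp.Eq (S.comp T) (T.comp S)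

/-- `T` is compact (as an operator on the subspace `S` of `H`): the image of the
closed unit ball of `S` is relatively compact. -/
def IsCompactOn (T : Hsp → Hsp) (S : Set Hsp) : Prop :=
  IsCompact (closure (T '' (Metric.closedBall 0 1 ∩ S)))

/-- `T` has squared Hilbert–Schmidt norm `v` on the subspace `S`:
`∑ᵣ ‖T eᵣ‖² = v` for some orthonormal basis `e` of `S`. -/
def HasHSNormSqOn (T : Hsp → Hsp) (S : Set Hsp) (v : ℝ) : Prop :=
  ∃ e : ℕ → Hsp, IsONBasisOn S e ∧ HasSum (fun r => ‖T (e r)‖ ^ 2) v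

/-- `T` is diagonal: there are an orthonormal basis `{φᵣ}` of `H` contained in `D(T)`
and quaternions `qᵣ` with `Tφᵣ = φᵣ qᵣ`. -/
def QOp.IsDiagonal (T : QOp) : Prop :=
  ∃ e : ℕ → Hsp, IsONBasisOn Set.univ e ∧ (∀ r, e r ∈ T.dom) ∧
    ∃ q : ℕ → Hq, ∀ r, T.app (e r) = rsmul (q r) (e r)

/-- The operator `Δ_q(N) = N² - N(q + q̄) + I|q|²` for a bounded operator `N`. -/
def sphDeltaB (N : Hsp → Hsp) (q : Hq) : Hsp → Hsp :=
  fun x => N (N x) - rsmul (q + star q) (N x) + rsmul ((normSq q : ℝ) : Hq) x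

/-- `q` lies in the spherical resolvent of the bounded operator `N`. -/
def inSphResolventB (N : Hsp → Hsp) (q : Hq) : Prop :=
  (∀ x, sphDeltaB N q x = 0 → x = 0) ∧
  Dense (Set.range (sphDeltaB N q)) ∧
  ∃ M : ℝ, ∀ x, ‖x‖ ≤ M * ‖sphDeltaB N q x‖

/-- The spherical spectrum of a bounded operator. -/
def sphSpectrumB (N : Hsp → Hsp) : Set Hq := {q | ¬ inSphResolventB N q}

/-- The domain `D(N²)` of the square of a partial operator. -/
def QOp.sqDom (N : QOp) : Set Hsp := {x ∈ N.dom | N.app x ∈ N.dom}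

/-- The map underlying `Δ_q(N) = N² - N(q + q̄) + I|q|²`, defined on `D(N²)`. -/
def sphDeltaU (N : QOp) (q : Hq) : Hsp → Hsp :=
  fun x => N.app (N.app x) - rsmul (q + star q) (N.app x) + rsmul ((normSq q : ℝ) : Hq) x

/-- `q` lies in the spherical resolvent of the operator `N ∈ C(H)`. -/
def inSphResolventU (N : QOp) (q : Hq) : Prop :=
  (∀ x ∈ N.sqDom, sphDeltaU N q x = 0 → x = 0) ∧
  Dense (sphDeltaU N q '' N.sqDom) ∧
  ∃ M : ℝ, ∀ x ∈ N.sqDom, ‖x‖ ≤ M * ‖sphDeltaU N q x‖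

/-- The spherical spectrum of `N ∈ C(H)`. -/
def sphSpectrumU (N : QOp) : Set Hq := {q | ¬ inSphResolventU N q}

/-- The circularization `Ω_K = {α + jβ : α + mβ ∈ K, j ∈ 𝕊}` of `K ⊆ ℂ_m`. -/
def circ (m : Hq) (K : Set Hq) : Set Hq :=
  {p | ∃ α β : ℝ, ∃ j ∈ QS, ((α : Hq) + m * (β : Hq) ∈ K) ∧ p = (α : Hq) + j * (β : Hq)}

section SelfAdjoint

open scoped InnerProductSpace

theorem sum_catalan_div_four_pow (n : ℕ) :
    ∑ i ∈ Finset.range n, (catalan i : ℝ) / 4 ^ i = 2 - 2 * (n.centralBinom : ℝ) / 4 ^ n := by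
  induction n with
  | zero => simp
  | succ n ih =>
    have h1 : ((n : ℝ) + 1) * (catalan n : ℝ) = n.centralBinom := by
      exact_mod_cast succ_mul_catalan_eq_centralBinom n
    have h2 : ((n : ℝ) + 1) * ((n + 1).centralBinom : ℝ)
        = 2 * (2 * (n : ℝ) + 1) * (n.centralBinom : ℝ) := by
      exact_mod_cast Nat.succ_mul_centralBinom_succ n
    have hn : (n : ℝ) + 1 ≠ 0 := by positivity
    rw [Finset.sum_range_succ, ih]
    have h3 : ((n + 1).centralBinom : ℝ) = 2 * (2 * (n : ℝ) + 1) * (catalan n : ℝ) := by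
      apply mul_left_cancel₀ hn
      rw [h2, ← h1]; ring
    rw [h3, ← h1, pow_succ]
    field_simp
    ring

theorem summable_catalan_div_four_pow : Summable fun n : ℕ => (catalan n : ℝ) / 4 ^ n :=
  summable_of_sum_range_le (c := 2) (fun _ => by positivity) fun n => by
    rw [sum_catalan_div_four_pow]
    have : (0 : ℝ) ≤ 2 * (n.centralBinom : ℝ) / 4 ^ n := by positivity
    linarith

theorem tsum_catalan_div_four_pow_le : ∑' n : ℕ, (catalan n : ℝ) / 4 ^ n ≤ 2 :=
  summable_catalan_div_four_pow.tsum_le_of_sum_range_le fun n => by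
    rw [sum_catalan_div_four_pow]
    have : (0 : ℝ) ≤ 2 * (n.centralBinom : ℝ) / 4 ^ n := by positivity
    linarith

/-- In a Banach algebra, if `‖w‖ ≤ 1` then the quadratic equation `u = 1 + w u² / 4` has a
solution with `‖u‖ ≤ 2`, given by the Catalan series; it commutes with everything commuting
with `w`. -/
theorem exists_catalan_series {𝔸 : Type*} [NormedRing 𝔸] [NormedAlgebra ℝ 𝔸] [CompleteSpace 𝔸]
    [NormOneClass 𝔸] [StarRing 𝔸] [ContinuousStar 𝔸] [StarModule ℝ 𝔸] (w : 𝔸) (hw : ‖w‖ ≤ 1) :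
    ∃ u : 𝔸, u = 1 + (4 : ℝ)⁻¹ • (w * (u * u)) ∧ ‖u‖ ≤ 2 ∧
      (IsSelfAdjoint w → IsSelfAdjoint u) ∧ ∀ z, Commute z w → Commute z u := by
  set f : ℕ → 𝔸 := fun n => ((catalan n : ℝ) / 4 ^ n) • w ^ n with hf
  have hnorm : ∀ n, ‖f n‖ ≤ (catalan n : ℝ) / 4 ^ n := fun n => by
    rw [hf, norm_smul, Real.norm_of_nonneg (by positivity)]
    exact mul_le_of_le_one_right (by positivity)
      ((norm_pow_le w n).trans (pow_le_one₀ (norm_nonneg _) hw))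
  have hs : Summable fun n => ‖f n‖ :=
    Summable.of_nonneg_of_le (fun _ => norm_nonneg _) hnorm summable_catalan_div_four_pow
  refine ⟨∑' n, f n, ?_, ?_, ?_, ?_⟩
  · rw [tsum_mul_tsum_eq_tsum_sum_antidiagonal_of_summable_norm hs hs, hs.of_norm.tsum_eq_zero_add]
    have hsum := (summable_norm_sum_mul_antidiagonal_of_summable_norm hs hs).of_norm
    congr 1
    · simp [hf]
    · rw [← hsum.tsum_mul_left, ← (hsum.mul_left w).tsum_const_smul]
      congr 1
      ext n
      have : ∀ kl ∈ Finset.HasAntidiagonal.antidiagonal n, f kl.1 * f kl.2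
          = ((catalan kl.1 * catalan kl.2 : ℝ) / 4 ^ n) • w ^ n := by
        intro kl hkl
        rw [Finset.HasAntidiagonal.mem_antidiagonal] at hkl
        rw [hf, smul_mul_smul_comm, ← pow_add, hkl, div_mul_div_comm, ← pow_add, hkl]
      rw [Finset.sum_congr rfl this, ← Finset.sum_smul, ← Finset.sum_div,
        mul_smul_comm, smul_smul, ← pow_succ']
      simp only [hf, catalan_succ']
      push_cast
      congr 1
      rw [pow_succ]; field_simp
  · exact (norm_tsum_le_tsum_norm hs).trans
      ((hs.tsum_le_tsum hnorm summable_catalan_div_four_pow).trans tsum_catalan_div_four_pow_le)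
  · intro h
    rw [IsSelfAdjoint, tsum_star]
    exact tsum_congr fun n => ((IsSelfAdjoint.all _).smul (h.pow n)).star_eq
  · intro z hz
    exact Commute.tsum_right z fun n => (hz.pow_right n).smul_right _

variable {E : Type*} [NormedAddCommGroup E] [InnerProductSpace ℝ E] [CompleteSpace E]

theorem IsSelfAdjoint.inner_comm_apply {X : E →L[ℝ] E} (hX : IsSelfAdjoint X) (x y : E) :
    ⟪X x, y⟫_ℝ = ⟪x, X y⟫_ℝ := by
  conv_lhs => rw [← hX.star_eq]
  exact ContinuousLinearMap.adjoint_inner_left X y x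

/-- The absolute value of a bounded self-adjoint operator. -/
theorem exists_abs_of_isSelfAdjoint {X : E →L[ℝ] E} (hX : IsSelfAdjoint X) :
    ∃ P : E →L[ℝ] E, IsSelfAdjoint P ∧ (∀ x, 0 ≤ ⟪P x, x⟫_ℝ) ∧ P * P = X * X ∧
      ∀ Z, Commute Z (X * X) → Commute Z P := by
  rcases subsingleton_or_nontrivial E with hE | hE
  · exact ⟨X, hX, fun x => by simp [Subsingleton.elim x 0], rfl,
      fun Z _ => by ext x; exact Subsingleton.elim _ _⟩
  set c : ℝ := ‖X‖ + 1 with hc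
  have hc0 : 0 < c := by positivity
  set Y := c⁻¹ • X with hY
  have hYsa : IsSelfAdjoint Y := (IsSelfAdjoint.all _).smul hX
  have hY1 : ‖Y‖ ≤ 1 := by
    rw [hY, norm_smul, Real.norm_of_nonneg (by positivity), inv_mul_le_iff₀ hc0]; linarith
  have hYle : ∀ x, ‖Y x‖ ≤ ‖x‖ := fun x => by
    simpa using (Y.le_of_opNorm_le hY1 x)
  set W : E →L[ℝ] E := 1 - Y * Y with hW
  have hWn : ‖W‖ ≤ 1 := by
    refine W.opNorm_le_bound zero_le_one fun x => ?_
    rw [one_mul, ← sq_le_sq₀ (norm_nonneg _) (norm_nonneg _)]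
    have : W x = x - Y (Y x) := by simp [hW]
    rw [this, norm_sub_sq_real, ← hYsa.inner_comm_apply, real_inner_self_eq_norm_sq]
    have := hYle (Y x)
    nlinarith [norm_nonneg (Y (Y x)), norm_nonneg (Y x)]
  obtain ⟨U, hU, hU2, hUs, hUc⟩ := exists_catalan_series W hWn
  have hWU : Commute W U := hUc W (Commute.refl W)
  have hWsa : IsSelfAdjoint W := by
    refine (IsSelfAdjoint.one _).sub ?_
    simpa [hYsa.star_eq] using IsSelfAdjoint.star_mul_self Y
  have hWUsa : IsSelfAdjoint (W * U) := by
    rw [IsSelfAdjoint, star_mul, (hUs hWsa).star_eq, hWsa.star_eq, hWU.eq]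
  have hWUn : ‖W * U‖ ≤ 2 := by
    refine (norm_mul_le W U).trans ?_
    nlinarith [norm_nonneg U, norm_nonneg W]
  set P : E →L[ℝ] E := 1 - (2 : ℝ)⁻¹ • (W * U) with hP
  have hPsa : IsSelfAdjoint P := (IsSelfAdjoint.one _).sub ((IsSelfAdjoint.all _).smul hWUsa)
  have hPP : P * P = Y * Y := by
    have h1 : W * U * (W * U) = (4 : ℝ) • (W * U - W) := by
      have h2 : W * (W * (U * U)) = (4 : ℝ) • (W * U - W) := by
        conv_rhs => rw [hU]
        rw [mul_add, mul_one, add_sub_cancel_left, mul_smul_comm, smul_smul]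
        norm_num
      rw [← h2, mul_assoc, ← mul_assoc U W U, ← hWU.eq, mul_assoc]
    have h3 : P * P = 1 - W * U + (4 : ℝ)⁻¹ • (W * U * (W * U)) := by
      rw [hP]
      simp only [sub_mul, mul_sub, one_mul, mul_one, smul_mul_assoc, mul_smul_comm]
      module
    rw [h3, h1, smul_smul]
    norm_num
    rw [hW]; abel
  have hPpos : ∀ x, 0 ≤ ⟪P x, x⟫_ℝ := fun x => by
    have h1 : ⟪(W * U) x, x⟫_ℝ ≤ 2 * ‖x‖ * ‖x‖ :=
      (real_inner_le_norm _ _).trans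
        (mul_le_mul_of_nonneg_right ((W * U).le_of_opNorm_le hWUn x) (norm_nonneg x))
    have h2 : ⟪P x, x⟫_ℝ = ‖x‖ * ‖x‖ - 2⁻¹ * ⟪(W * U) x, x⟫_ℝ := by
      rw [hP, sub_apply, inner_sub_left, smul_apply,
        real_inner_smul_left, one_apply_eq_self, real_inner_self_eq_norm_mul_norm]
    rw [h2]; linarith
  refine ⟨c • P, (IsSelfAdjoint.all _).smul hPsa, fun x => ?_, ?_, fun Z hZ => ?_⟩
  · rw [smul_apply, real_inner_smul_left]
    exact mul_nonneg hc0.le (hPpos x)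
  · rw [smul_mul_smul_comm, hPP, hY, smul_mul_smul_comm, smul_smul]
    have : c * c * (c⁻¹ * c⁻¹) = 1 := by field_simp
    rw [this, one_smul]
  · have hZW : Commute Z W := by
      refine (Commute.one_right Z).sub_right ?_
      rw [hY, smul_mul_smul_comm]
      exact hZ.smul_right _
    exact ((Commute.one_right Z).sub_right ((hZW.mul_right (hUc Z hZW)).smul_right _)).smul_right _

theorem Submodule.commute_starProjection {V : Submodule ℝ E} [V.HasOrthogonalProjection]
    {Z : E →L[ℝ] E} (h : ∀ x ∈ V, Z x ∈ V) (h' : ∀ x ∈ V, star Z x ∈ V) :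
    Commute Z V.starProjection := by
  ext x
  change Z (V.starProjection x) = V.starProjection (Z x)
  refine (Submodule.eq_starProjection_of_mem_of_inner_eq_zero
    (h _ (V.starProjection_apply_mem x)) fun w hw => ?_).symm
  rw [← map_sub, ← ContinuousLinearMap.adjoint_inner_right]
  exact V.starProjection_inner_eq_zero x _ (h' w hw)

/-- The orthogonal projection onto the kernel of a bounded self-adjoint operator. -/
theorem exists_kernel_projection {X : E →L[ℝ] E} (hX : IsSelfAdjoint X) :
    ∃ e : E →L[ℝ] E, IsSelfAdjoint e ∧ e * e = e ∧ X * e = 0 ∧ (∀ x, X x = 0 → e x = x) ∧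
      ∀ Z, Commute Z X → Commute Z e := by
  have hcl : IsClosed (LinearMap.ker (X : E →ₗ[ℝ] E) : Set E) := X.isClosed_ker
  have : CompleteSpace (LinearMap.ker (X : E →ₗ[ℝ] E)) := hcl.completeSpace_coe
  set V := LinearMap.ker (X : E →ₗ[ℝ] E)
  have hinv : ∀ Z : E →L[ℝ] E, Commute Z X → ∀ x ∈ V, Z x ∈ V := fun Z hZ x hx => by
    have hx' : X x = 0 := hx
    have : X (Z x) = Z (X x) := (DFunLike.congr_fun hZ.eq x).symm
    change X (Z x) = 0
    rw [this, hx', map_zero]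
  refine ⟨V.starProjection, isSelfAdjoint_starProjection V, V.isIdempotentElem_starProjection,
    ?_, fun x hx => Submodule.starProjection_eq_self_iff.2 hx, fun Z hZ => ?_⟩
  · ext x
    exact V.starProjection_apply_mem x
  · have hZs : Commute (star Z) X := by simpa [hX.star_eq] using hZ.star_star
    exact Submodule.commute_starProjection (hinv Z hZ) (hinv _ hZs)

/-- The polar decomposition `X = P u` of a bounded self-adjoint operator with a symmetry `u`. -/
theorem exists_sign {X : E →L[ℝ] E} (hX : IsSelfAdjoint X) :
    ∃ u P : E →L[ℝ] E, IsSelfAdjoint u ∧ u * u = 1 ∧ IsSelfAdjoint P ∧ (∀ x, 0 ≤ ⟪P x, x⟫_ℝ) ∧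
      P * P = X * X ∧ X * u = P ∧ (∀ Z, Commute Z (X * X) → Commute Z P) ∧
      ∀ Z, Commute Z X → Commute Z u := by
  obtain ⟨P, hP, hpos, hPP, hPc⟩ := exists_abs_of_isSelfAdjoint hX
  have hXP : Commute X P := hPc X ((Commute.refl X).mul_right (Commute.refl X))
  obtain ⟨e, he, hee, hXe, hker, hec⟩ := exists_kernel_projection (hP.sub hX)
  have hecomm : ∀ Z, Commute Z X → Commute Z e := fun Z hZ =>
    hec Z ((hPc Z (hZ.mul_right hZ)).sub_right hZ)
  have hu : ∀ Z, Commute Z X → Commute Z (2 * e - 1) := fun Z hZ =>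
    (((Commute.ofNat_right Z 2)).mul_right (hecomm Z hZ)).sub_right (Commute.one_right Z)
  refine ⟨2 * e - 1, P, ?_, ?_, hP, hpos, hPP, ?_, hPc, hu⟩
  · refine IsSelfAdjoint.sub ?_ (IsSelfAdjoint.one _)
    rw [two_mul]; exact he.add he
  · have : (2 * e - 1) * (2 * e - 1) = 4 * (e * e) - 4 * e + 1 := by noncomm_ring
    rw [this, hee]; noncomm_ring
  · have h1 : X * e = P * e := by
      rw [sub_mul, sub_eq_zero] at hXe; exact hXe.symm
    have h2 : (P + X) * e = P + X := by
      have h3 : e * (P + X) = P + X := by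
        ext x
        refine hker _ ?_
        change ((P - X) * (P + X)) x = 0
        have : (P - X) * (P + X) = 0 := by
          have : (P - X) * (P + X) = P * P - X * X + (P * X - X * P) := by noncomm_ring
          rw [this, hPP, hXP.eq]; simp
        rw [this]; rfl
      have h4 : Commute e (P + X) :=
        ((hecomm P hXP.symm).add_left (hecomm X (Commute.refl X))).symm
      rw [← h4.eq, h3]
    have h5 : X * (2 * e - 1) = X * e + X * e - X := by noncomm_ring
    rw [h5]
    nth_rewrite 1 [h1]
    rw [← add_mul, h2]; abel

theorem norm_two_smul_sub_le {A u P : E →L[ℝ] E} (hA1 : ‖A‖ ≤ 1) (hA : IsSelfAdjoint A)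
    (hu : IsSelfAdjoint u) (huu : u * u = 1)
    (hP : IsSelfAdjoint P) (hpos : ∀ x, 0 ≤ ⟪P x, x⟫_ℝ) (hPP : P * P = A * A)
    (hAu : A * u = P) : ‖(2 : ℝ) • A - u‖ ≤ 1 := by
  have hPA : ∀ x, ‖P x‖ = ‖A x‖ := fun x => by
    rw [← sq_eq_sq₀ (norm_nonneg _) (norm_nonneg _), ← real_inner_self_eq_norm_sq,
      ← real_inner_self_eq_norm_sq, hP.inner_comm_apply, hA.inner_comm_apply]
    exact congrArg _ (DFunLike.congr_fun hPP x)
  have hun : ∀ x, ‖u x‖ = ‖x‖ := fun x => by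
    rw [← sq_eq_sq₀ (norm_nonneg _) (norm_nonneg _), ← real_inner_self_eq_norm_sq,
      ← real_inner_self_eq_norm_sq, hu.inner_comm_apply]
    exact congrArg _ (DFunLike.congr_fun huu x)
  have hPn : ∀ x, ‖P x‖ ≤ ‖x‖ := fun x => by
    rw [hPA]; simpa using A.le_of_opNorm_le hA1 x
  refine ContinuousLinearMap.opNorm_le_bound _ zero_le_one fun x => ?_
  have hx : x = u (u x) := (DFunLike.congr_fun huu x).symm
  have h1 : ((2 : ℝ) • A - u) x = (2 : ℝ) • P (u x) - u x := by
    have : A x = P (u x) := by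
      rw [← hAu, mul_apply_eq_comp, ← hx]
    simp [this]
  rw [h1, one_mul, ← hun x]
  set y := u x
  rw [← sq_le_sq₀ (norm_nonneg _) (norm_nonneg _), norm_sub_sq_real, real_inner_smul_left,
    norm_smul, mul_pow]
  have h2 := hpos (y - P y)
  rw [map_sub, inner_sub_left, inner_sub_right, inner_sub_right, hP.inner_comm_apply (P y) y,
    real_inner_self_eq_norm_sq] at h2
  have h3 : ⟪P (P y), P y⟫_ℝ ≤ ‖P y‖ ^ 2 := (real_inner_le_norm _ _).trans (by
    rw [sq]; exact mul_le_mul_of_nonneg_right (hPn _) (norm_nonneg _))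
  norm_num
  nlinarith

/-- The signed binary expansion of a bounded self-adjoint operator into commuting symmetries. -/
theorem exists_signed_digits {A : E →L[ℝ] E} (hA : IsSelfAdjoint A) :
    ∃ (u : ℕ → E →L[ℝ] E) (c : ℕ → ℝ) (M : ℝ), 0 ≤ M ∧
      (∀ n, IsSelfAdjoint (u n)) ∧ (∀ n, u n * u n = 1) ∧
      (∀ n Z, Commute Z A → Commute Z (u n)) ∧
      ∀ n, ‖A - ∑ j ∈ Finset.range n, c j • u j‖ ≤ M / 2 ^ n := by
  set M : ℝ := ‖A‖ + 1 with hM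
  have hM0 : 0 < M := by positivity
  let S := {r : E →L[ℝ] E // IsSelfAdjoint r ∧ ‖r‖ ≤ 1 ∧ ∀ Z, Commute Z A → Commute Z r}
  have key : ∀ r : S, ∃ u : E →L[ℝ] E, ∃ next : S, IsSelfAdjoint u ∧ u * u = 1 ∧
      (∀ Z, Commute Z A → Commute Z u) ∧ next.1 = (2 : ℝ) • r.1 - u := fun ⟨r, hr, hr1, hrc⟩ => by
    obtain ⟨u, P, hu, huu, hP, hpos, hPP, hru, -, huc⟩ := exists_sign hr
    exact ⟨u, ⟨(2 : ℝ) • r - u, ((IsSelfAdjoint.all _).smul hr).sub hu,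
      norm_two_smul_sub_le hr1 hr hu huu hP hpos hPP hru,
      fun Z hZ => ((hrc Z hZ).smul_right _).sub_right (huc Z (hrc Z hZ))⟩, hu, huu,
      fun Z hZ => huc Z (hrc Z hZ), rfl⟩
  choose u next hu huu huc hr' using key
  let r0 : S := ⟨M⁻¹ • A, (IsSelfAdjoint.all _).smul hA, by
    rw [norm_smul, Real.norm_of_nonneg (by positivity), inv_mul_le_iff₀ hM0]; linarith,
    fun Z hZ => hZ.smul_right _⟩
  let r : ℕ → S := fun n => next^[n] r0
  have hr : ∀ n, (r (n + 1)).1 = (2 : ℝ) • (r n).1 - u (r n) := fun n => by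
    simp only [r, Function.iterate_succ_apply']
    exact hr' _
  have hexp : ∀ n, A - ∑ j ∈ Finset.range n, (M / 2 ^ (j + 1)) • u (r j) = (M / 2 ^ n) •
      (r n).1 := by
    intro n
    induction n with
    | zero => simp [r, r0, smul_smul, hM0.ne']
    | succ n ih =>
      rw [Finset.sum_range_succ, ← sub_sub, ih, hr, smul_sub, smul_smul]
      congr 2
      rw [pow_succ]; field_simp
  refine ⟨fun n => u (r n), fun j => M / 2 ^ (j + 1), M, hM0.le, fun n => hu _, fun n => huu _,
    fun n => huc _, fun n => ?_⟩
  rw [hexp, norm_smul, Real.norm_of_nonneg (by positivity)]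
  exact mul_le_of_le_one_right (by positivity) (r n).2.2.1

end SelfAdjoint

section Blocks

open scoped InnerProductSpace

/-- Finite-dimensional subspaces can be enlarged to finite-dimensional subspaces invariant under
finitely many commuting operators satisfying cubic equations `Z³ = c Z`. -/
theorem exists_finiteDimensional_invariant {E : Type*} [NormedAddCommGroup E]
    [InnerProductSpace ℝ E] (R : Set (E →L[ℝ] E)) {L : Set (E →L[ℝ] E)} (hL : L.Finite)
    (hcomm : ∀ Z ∈ L, ∀ Y ∈ L ∪ R, Commute Z Y) (hcub : ∀ Z ∈ L, ∃ c : ℝ, Z * Z * Z = c • Z)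
    (F : Submodule ℝ E) [FiniteDimensional ℝ F] (hF : ∀ Y ∈ R, ∀ x ∈ F, Y x ∈ F) :
    ∃ F' : Submodule ℝ E, FiniteDimensional ℝ F' ∧ F ≤ F' ∧ ∀ Y ∈ L ∪ R, ∀ x ∈ F', Y x ∈ F' := by
  induction L, hL using Set.Finite.induction_on with
  | empty => exact ⟨F, ‹_›, le_rfl, by simpa using hF⟩
  | @insert Z L hZ hL ih =>
    obtain ⟨F', hfd, hle, hinv⟩ := ih
      (fun Z' hZ' Y hY => hcomm Z' (Or.inr hZ') Y (hY.imp_left Or.inr))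
      (fun Z' hZ' => hcub Z' (Or.inr hZ'))
    have hcZ : ∀ Y ∈ L ∪ R, ∀ x, Y (Z x) = Z (Y x) := fun Y hY x =>
      (DFunLike.congr_fun (hcomm Z (Or.inl rfl) Y (hY.imp_left Or.inr)).eq x).symm
    obtain ⟨c, hc⟩ := hcub Z (Or.inl rfl)
    have hc' : ∀ x, Z (Z (Z x)) = c • Z x := fun x => DFunLike.congr_fun hc x
    set z : E →ₗ[ℝ] E := (Z : E →ₗ[ℝ] E)
    refine ⟨F' ⊔ F'.map z ⊔ (F'.map z).map z, inferInstance,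
      hle.trans (le_sup_left.trans le_sup_left), fun Y hY x hx => ?_⟩
    obtain ⟨x', hx', _, ⟨_, ⟨x₃, hx₃, rfl⟩, rfl⟩, rfl⟩ := Submodule.mem_sup.1 hx
    obtain ⟨x₁, hx₁, _, ⟨x₂, hx₂, rfl⟩, rfl⟩ := Submodule.mem_sup.1 hx'
    have hm1 : ∀ w ∈ F', w ∈ F' ⊔ F'.map z ⊔ (F'.map z).map z := fun w hw =>
      Submodule.mem_sup_left (Submodule.mem_sup_left hw)
    have hm2 : ∀ w ∈ F', Z w ∈ F' ⊔ F'.map z ⊔ (F'.map z).map z := fun w hw =>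
      Submodule.mem_sup_left (Submodule.mem_sup_right ⟨w, hw, rfl⟩)
    have hm3 : ∀ w ∈ F', Z (Z w) ∈ F' ⊔ F'.map z ⊔ (F'.map z).map z := fun w hw =>
      Submodule.mem_sup_right ⟨_, ⟨w, hw, rfl⟩, rfl⟩
    change Y (x₁ + Z x₂ + Z (Z x₃)) ∈ _
    rw [map_add, map_add]
    have hY' : Y = Z ∨ Y ∈ L ∪ R := by
      rcases hY with (h | h) | h
      exacts [Or.inl h, Or.inr (Or.inl h), Or.inr (Or.inr h)]
    rcases hY' with rfl | hY'
    · rw [hc']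
      exact add_mem (add_mem (hm2 _ hx₁) (hm3 _ hx₂)) (Submodule.smul_mem _ _ (hm2 _ hx₃))
    · rw [hcZ Y hY', hcZ Y hY', hcZ Y hY']
      exact add_mem (add_mem (hm1 _ (hinv Y hY' _ hx₁)) (hm2 _ (hinv Y hY' _ hx₂)))
        (hm3 _ (hinv Y hY' _ hx₃))

theorem isCompactOperator_starProjection {E : Type*} [NormedAddCommGroup E]
    [InnerProductSpace ℝ E] (F : Submodule ℝ E) [FiniteDimensional ℝ F] :
    IsCompactOperator F.starProjection := by
  have h : IsCompactOperator F.subtypeL :=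
    have := FiniteDimensional.proper ℝ F
    isCompactOperator_of_locallyCompactSpace_rng F.subtypeL
  exact h.comp_clm F.orthogonalProjectionOnto

variable {E : Type*} [NormedAddCommGroup E] [InnerProductSpace ℝ E] [CompleteSpace E]

/-- Given right multiplications `ρ q` and an increasing sequence of finite sets `L k` of commuting
operators, there is an exhausting increasing sequence of finite-dimensional quaternionic
subspaces such that the `k`-th subspace is invariant under `L k`. -/
theorem exists_invariant_filtration [TopologicalSpace.SeparableSpace E]
    (ρ : (ℍ[ℝ])ᵐᵒᵖ →⋆ₐ[ℝ] (E →L[ℝ] E)) (L : ℕ → Set (E →L[ℝ] E))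
    (hfin : ∀ k, (L k).Finite)
    (hcomm : ∀ k, ∀ Z ∈ L k, ∀ Y ∈ L k, Commute Z Y)
    (hcub : ∀ k, ∀ Z ∈ L k, ∃ c : ℝ, Z * Z * Z = c • Z)
    (hρ : ∀ k, ∀ Z ∈ L k, ∀ q, Commute Z (ρ q)) :
    ∃ F : ℕ → Submodule ℝ E, F 0 = ⊥ ∧ Monotone F ∧ (∀ k, FiniteDimensional ℝ (F k)) ∧
      (∀ k q, ∀ x ∈ F k, ρ q x ∈ F k) ∧ (∀ k, ∀ Z ∈ L k, ∀ x ∈ F k, Z x ∈ F k) ∧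
      ∀ k, TopologicalSpace.denseSeq E k ∈ F (k + 1) := by
  let S := {F : Submodule ℝ E // FiniteDimensional ℝ F ∧ ∀ q, ∀ x ∈ F, ρ q x ∈ F}
  have step : ∀ (k : ℕ) (F : S), ∃ F' : S, F.1 ≤ F'.1 ∧ TopologicalSpace.denseSeq E k ∈ F'.1 ∧
      ∀ Z ∈ L (k + 1), ∀ x ∈ F'.1, Z x ∈ F'.1 := fun k ⟨F, hfd, hFρ⟩ => by
    set y := TopologicalSpace.denseSeq E k
    let O : (ℍ[ℝ])ᵐᵒᵖ →ₗ[ℝ] E :=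
      { toFun := fun q => ρ q y
        map_add' := fun p q => by rw [map_add]; rfl
        map_smul' := fun c q => by rw [map_smul]; rfl }
    have hFO : ∀ Y ∈ Set.range ρ, ∀ x ∈ F ⊔ LinearMap.range O, Y x ∈ F ⊔ LinearMap.range O := by
      rintro _ ⟨q, rfl⟩ x hx
      obtain ⟨x₁, hx₁, _, ⟨p, rfl⟩, rfl⟩ := Submodule.mem_sup.1 hx
      rw [map_add]
      refine add_mem (Submodule.mem_sup_left (hFρ q _ hx₁)) (Submodule.mem_sup_right ⟨q * p, ?_⟩)
      change ρ (q * p) y = ρ q (ρ p y)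
      rw [map_mul]; rfl
    have : FiniteDimensional ℝ (ℍ[ℝ])ᵐᵒᵖ :=
      Module.Finite.equiv (MulOpposite.opLinearEquiv ℝ (M := ℍ[ℝ]))
    obtain ⟨F', hfd', hle, hinv⟩ := exists_finiteDimensional_invariant (Set.range ρ)
      (hfin (k + 1)) (fun Z hZ Y hY => by
        rcases hY with hY | ⟨q, rfl⟩
        exacts [hcomm _ Z hZ Y hY, hρ _ Z hZ q]) (hcub (k + 1)) (F ⊔ LinearMap.range O) hFO
    refine ⟨⟨F', hfd', fun q => hinv _ (Or.inr ⟨q, rfl⟩)⟩, le_sup_left.trans hle,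
      hle (Submodule.mem_sup_right ⟨1, ?_⟩), fun Z hZ => hinv Z (Or.inl hZ)⟩
    change ρ 1 y = y
    rw [map_one]; rfl
  choose next hle hmem hinv using step
  set F : ℕ → S := fun n => Nat.rec ⟨⊥, inferInstance, by simp⟩ next n with hF
  have hF0 : (F 0).1 = ⊥ := rfl
  have hFs : ∀ k, F (k + 1) = next k (F k) := fun k => rfl
  clear_value F
  refine ⟨fun k => (F k).1, hF0, monotone_nat_of_le_succ fun k => ?_, fun k => (F k).2.1,
    fun k => (F k).2.2, ?_, fun k => ?_⟩
  · rw [hFs]; exact hle k (F k)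
  · rintro (_ | k) Z hZ x hx
    · change x ∈ (F 0).1 at hx
      change Z x ∈ (F 0).1
      rw [hF0, Submodule.mem_bot] at hx ⊢
      rw [hx, map_zero]
    · change x ∈ (F (k + 1)).1 at hx
      change Z x ∈ (F (k + 1)).1
      rw [hFs] at hx ⊢
      exact hinv k (F k) Z hZ x hx
  · change _ ∈ (F (k + 1)).1
    rw [hFs]; exact hmem k (F k)

/-- A quaternionic structure given by right multiplications `ρ q`, together with an increasing
sequence of finite sets `L k` of commuting operators, yields a decomposition of the space into
finite-dimensional blocks such that the `k`-th block reduces all operators in `L k`. -/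
theorem exists_block_projections [TopologicalSpace.SeparableSpace E]
    (ρ : (ℍ[ℝ])ᵐᵒᵖ →⋆ₐ[ℝ] (E →L[ℝ] E)) (L : ℕ → Set (E →L[ℝ] E))
    (hmono : ∀ k, L k ⊆ L (k + 1)) (hfin : ∀ k, (L k).Finite)
    (hcomm : ∀ k, ∀ Z ∈ L k, ∀ Y ∈ L k, Commute Z Y)
    (hcub : ∀ k, ∀ Z ∈ L k, ∃ c : ℝ, Z * Z * Z = c • Z)
    (hstar : ∀ k, ∀ Z ∈ L k, star Z = Z ∨ star Z = -Z)
    (hρ : ∀ k, ∀ Z ∈ L k, ∀ q, Commute Z (ρ q)) :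
    ∃ Q : ℕ → E →L[ℝ] E, (∀ k, IsStarProjection (Q k)) ∧ (∀ k l, k ≠ l → Q k * Q l = 0) ∧
      (∀ k, IsCompactOperator (Q k)) ∧ (∀ k q, Commute (Q k) (ρ q)) ∧
      (∀ k, ∀ Z ∈ L k, Commute (Q k) Z) ∧ ∀ x, (∀ k, Q k x = 0) → x = 0 := by
  obtain ⟨F, hF0, hFmono, hfd, hFρ, hFinv, hmem⟩ :=
    exists_invariant_filtration ρ L hfin hcomm hcub hρ
  set P : ℕ → E →L[ℝ] E := fun k => (F k).starProjection with hP
  have hPinv : ∀ k (Z : E →L[ℝ] E), (star Z = Z ∨ star Z = -Z) → (∀ x ∈ F k, Z x ∈ F k) →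
      Commute (P k) Z := fun k Z hs hZ => by
    refine (Submodule.commute_starProjection hZ fun x hx => ?_).symm
    rcases hs with h | h
    · rw [h]; exact hZ x hx
    · rw [h]; exact neg_mem (hZ x hx)
  have hPρ : ∀ k q, Commute (P k) (ρ q) := fun k q => by
    refine (Submodule.commute_starProjection (hFρ k q) fun x hx => ?_).symm
    rw [← map_star]
    exact hFρ k _ x hx
  have hPle : ∀ k l, k ≤ l → P k * P l = P k := fun k l h =>
    Submodule.starProjection_comp_starProjection_of_le (hFmono h)
  have hPsa : ∀ k, IsSelfAdjoint (P k) := fun k => isSelfAdjoint_starProjection _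
  have hPle' : ∀ k l, k ≤ l → P l * P k = P k := fun k l h => by
    simpa [(hPsa k).star_eq, (hPsa l).star_eq] using congrArg star (hPle k l h)
  have horth : ∀ k l, k < l → (P (k + 1) - P k) * (P (l + 1) - P l) = 0 := fun k l h => by
    rw [sub_mul, mul_sub, mul_sub, hPle (k + 1) (l + 1) (by lia), hPle (k + 1) l (by lia),
      hPle k (l + 1) (by lia), hPle k l (by lia)]
    abel
  have hQsa : ∀ k, IsSelfAdjoint (P (k + 1) - P k) := fun k => (hPsa _).sub (hPsa _)
  refine ⟨fun k => P (k + 1) - P k, fun k => ⟨?_, hQsa k⟩, fun k l hkl => ?_, fun k => ?_,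
    fun k q => (hPρ _ q).sub_left (hPρ _ q), fun k Z hZ => ?_, fun x hx => ?_⟩
  · change (P (k + 1) - P k) * (P (k + 1) - P k) = P (k + 1) - P k
    rw [sub_mul, mul_sub, mul_sub, hPle _ _ le_rfl, hPle _ _ le_rfl, hPle' _ _ k.le_succ,
      hPle _ _ k.le_succ]
    abel
  · rcases lt_or_gt_of_ne hkl with h | h
    · exact horth k l h
    · simpa [(hQsa k).star_eq, (hQsa l).star_eq] using congrArg star (horth l k h)
  · exact (isCompactOperator_starProjection (F (k + 1))).sub
      (isCompactOperator_starProjection (F k))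
  · exact (hPinv _ Z (hstar k Z hZ) (hFinv _ Z (hmono k hZ))).sub_left
      (hPinv _ Z (hstar k Z hZ) (hFinv _ Z hZ))
  · have hPx : ∀ k, P k x = 0 := fun k => by
      induction k with
      | zero =>
        simp [hP, hF0]
      | succ k ih => simpa [ih] using hx k
    refine (TopologicalSpace.denseRange_denseSeq E).eq_zero_of_inner_left (𝕜 := ℝ) ?_
    intro k
    have h1 := Submodule.starProjection_inner_eq_zero (K := F (k + 1)) x _ (hmem k)
    have h2 : (F (k + 1)).starProjection x = 0 := hPx (k + 1)
    rwa [h2, sub_zero] at h1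

end Blocks

section Diagonalization

open scoped InnerProductSpace

variable {E : Type*} [NormedAddCommGroup E] [InnerProductSpace ℝ E]

/-- Finitely many commuting symmetries have a common eigenvector in every nonzero invariant
subspace. -/
theorem exists_common_eigenvector_of_symmetries {𝓢 : Set (E →L[ℝ] E)} (hfin : 𝓢.Finite)
    (hsq : ∀ u ∈ 𝓢, u * u = 1) (hcomm : ∀ u ∈ 𝓢, ∀ w ∈ 𝓢, Commute u w) {W : Submodule ℝ E}
    (hW : W ≠ ⊥) (hinv : ∀ u ∈ 𝓢, ∀ x ∈ W, u x ∈ W) :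
    ∃ v ∈ W, v ≠ 0 ∧ ∀ u ∈ 𝓢, u v = v ∨ u v = -v := by
  induction 𝓢, hfin using Set.Finite.induction_on with
  | empty =>
    obtain ⟨v, hv, hv0⟩ := W.exists_mem_ne_zero_of_ne_bot hW
    exact ⟨v, hv, hv0, by simp⟩
  | @insert u 𝓢 hu hfin ih =>
    obtain ⟨v, hv, hv0, hev⟩ := ih (fun w hw => hsq w (Or.inr hw))
      (fun w hw w' hw' => hcomm w (Or.inr hw) w' (Or.inr hw')) fun w hw => hinv w (Or.inr hw)
    have huu : u (u v) = v := DFunLike.congr_fun (hsq u (Or.inl rfl)) v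
    by_cases hy : v + u v = 0
    · refine ⟨v, hv, hv0, ?_⟩
      rintro w (rfl | hw)
      exacts [Or.inr (eq_neg_of_add_eq_zero_right hy), hev w hw]
    · refine ⟨v + u v, add_mem hv (hinv u (Or.inl rfl) v hv), hy, ?_⟩
      rintro w (rfl | hw)
      · left
        rw [map_add, huu, add_comm]
      · have hwu : w (u v) = u (w v) :=
          DFunLike.congr_fun (hcomm w (Or.inr hw) u (Or.inl rfl)).eq v
        rw [map_add, hwu]
        rcases hev w hw with h | h
        · left; rw [h]
        · right; rw [h, map_neg, neg_add]

/-- Finitely many commuting symmetries and a commuting partial complex structure `J` have a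
common eigenvector with respect to a given complex structure `I`. -/
theorem exists_common_eigenvector {𝓢 : Set (E →L[ℝ] E)} (hfin : 𝓢.Finite)
    (hsq : ∀ u ∈ 𝓢, u * u = 1) (hcomm : ∀ u ∈ 𝓢, ∀ w ∈ 𝓢, Commute u w)
    {I J z : E →L[ℝ] E} (hII : I * I = -1) (hJJ : J * J = z - 1) (hJz : J * z = 0)
    (hz : 2 * z - 1 ∈ 𝓢) (hIJ : Commute I J) (hI : ∀ u ∈ 𝓢, Commute u I)
    (hJ : ∀ u ∈ 𝓢, Commute u J) {W : Submodule ℝ E}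
    (hW : W ≠ ⊥) (hinv : ∀ u ∈ 𝓢, ∀ x ∈ W, u x ∈ W) (hWI : ∀ x ∈ W, I x ∈ W)
    (hWJ : ∀ x ∈ W, J x ∈ W) :
    ∃ v ∈ W, ‖v‖ = 1 ∧ (∀ u ∈ 𝓢, ∃ c : ℝ, u v = c • v) ∧ ∃ t : ℝ, J v = t • I v := by
  suffices h : ∃ v ∈ W, v ≠ 0 ∧ (∀ u ∈ 𝓢, ∃ c : ℝ, u v = c • v) ∧ ∃ t : ℝ, J v = t • I v by
    obtain ⟨v, hv, hv0, hev, t, ht⟩ := h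
    refine ⟨‖v‖⁻¹ • v, W.smul_mem _ hv, norm_smul_inv_norm hv0, fun u hu => ?_, t, ?_⟩
    · obtain ⟨c, hc⟩ := hev u hu
      exact ⟨c, by rw [map_smul, hc, smul_comm]⟩
    · rw [map_smul, map_smul, ht, smul_comm]
  obtain ⟨v, hv, hv0, hev⟩ := exists_common_eigenvector_of_symmetries hfin hsq hcomm hW hinv
  have hev' : ∀ u ∈ 𝓢, ∃ c : ℝ, u v = c • v := fun u hu => by
    rcases hev u hu with h | h
    exacts [⟨1, by rw [h, one_smul]⟩, ⟨-1, by rw [h, neg_one_smul]⟩]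
  have hzv : (2 * z - 1) v = (2 : ℝ) • z v - v := by
    rw [two_smul, two_mul]; rfl
  have hJJv : J (J v) = z v - v := DFunLike.congr_fun hJJ v
  have hJzv : J (z v) = 0 := DFunLike.congr_fun hJz v
  have hIIv : ∀ x, I (I x) = -x := fun x => DFunLike.congr_fun hII x
  have hIJv : ∀ x, I (J x) = J (I x) := fun x => DFunLike.congr_fun hIJ.eq x
  rcases hev _ hz with h | h
  · rw [hzv, sub_eq_iff_eq_add, ← two_smul ℝ v] at h
    have h' : z v = v := smul_right_injective E (two_ne_zero (α := ℝ)) h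
    exact ⟨v, hv, hv0, hev', 0, by rw [zero_smul, ← h', hJzv]⟩
  · rw [hzv, sub_eq_iff_eq_add, neg_add_cancel] at h
    have h' : z v = 0 := (smul_eq_zero.1 h).resolve_left two_ne_zero
    rw [h', zero_sub] at hJJv
    by_cases hy : v - I (J v) = 0
    · refine ⟨v, hv, hv0, hev', -1, ?_⟩
      rw [neg_one_smul, (congrArg I (sub_eq_zero.1 hy)).trans (hIIv _), neg_neg]
    · refine ⟨v - I (J v), sub_mem hv (hWI _ (hWJ _ hv)), hy, fun u hu => ?_, 1, ?_⟩
      · obtain ⟨c, hc⟩ := hev' u hu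
        have h1 : u (I (J v)) = I (J (u v)) :=
          (DFunLike.congr_fun (hI u hu).eq (J v)).trans
            (congrArg I (DFunLike.congr_fun (hJ u hu).eq v))
        exact ⟨c, by rw [map_sub, h1, hc, map_smul, map_smul, smul_sub]⟩
      · rw [one_smul, map_sub, map_sub, ← hIJv, hJJv, hIIv, map_neg]
        abel

variable [CompleteSpace E]

/-- Polar decomposition of a bounded skew-adjoint operator commuting with a complex structure. -/
theorem exists_skew_polar {B I : E →L[ℝ] E} (hB : star B = -B) (hI : star I = -I)
    (hII : I * I = -1) (hBI : Commute B I) :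
    ∃ J P z : E →L[ℝ] E, star J = -J ∧ J * J = z - 1 ∧ J * z = 0 ∧ IsSelfAdjoint z ∧ z * z = z ∧
      IsSelfAdjoint P ∧ J * P = B ∧
      ∀ Z, Commute Z B → Commute Z J ∧ Commute Z P ∧ Commute Z z := by
  have hIB : I * B = B * I := hBI.eq.symm
  have hY : IsSelfAdjoint (-(B * I)) := by
    rw [isSelfAdjoint_iff, star_neg, star_mul, hB, hI, neg_mul_neg, hIB]
  have hYY : -(B * I) * -(B * I) = -(B * B) := by
    rw [neg_mul_neg, mul_assoc, ← mul_assoc I B, hIB, mul_assoc B I, hII]; simp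
  obtain ⟨u, P, hu, huu, hP, -, -, hYu, hPc, huc⟩ := exists_sign hY
  obtain ⟨z, hz, hzz, hPz, hker, hzc⟩ := exists_kernel_projection hP
  have hcP : ∀ Z, Commute Z B → Commute Z P := fun Z hZ =>
    hPc Z (by rw [hYY]; exact (hZ.mul_right hZ).neg_right)
  have hIY : Commute I (-(B * I)) := (hBI.symm.mul_right (Commute.refl I)).neg_right
  have hIu : I * u = u * I := (huc I hIY).eq
  have hIP : I * P = P * I := (hPc I (hIY.mul_right hIY)).eq
  have hIz : I * z = z * I := (hzc I hIP).eq
  have huY : Commute u (-(B * I)) := (huc _ (Commute.refl _)).symm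
  have huP : u * P = P * u := (hPc u (huY.mul_right huY)).eq
  have huz : u * z = z * u := (hzc u huP).eq
  have hzP : z * P = 0 := by
    simpa [hz.star_eq, hP.star_eq] using congrArg star hPz
  have hBe : u * (P * I) = B := by
    rw [← hYu, mul_assoc _ u I, ← hIu, ← mul_assoc, ← mul_assoc, huY.eq, mul_assoc _ u I, ← hIu,
      ← mul_assoc, mul_assoc _ u u, huu, mul_one, neg_mul, mul_assoc, hII, mul_neg_one, neg_neg]
  set e : E →L[ℝ] E := 1 - z with he
  have hee : e * e = e := by rw [he, mul_sub, sub_mul, sub_mul, hzz]; simp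
  have hIe : I * e = e * I := by rw [he, mul_sub, sub_mul, hIz, mul_one, one_mul]
  have hue : u * e = e * u := by rw [he, mul_sub, sub_mul, huz, mul_one, one_mul]
  have heP : e * P = P := by rw [he, sub_mul, hzP, one_mul, sub_zero]
  have hez : e * z = 0 := by rw [he, sub_mul, hzz, one_mul, sub_self]
  have hesa : star e = e := by rw [he, star_sub, star_one, hz.star_eq]
  have hJP : u * e * I * P = B := by
    rw [mul_assoc, hIP, ← mul_assoc, mul_assoc u, heP, mul_assoc, hBe]
  have hJz : u * e * I * z = 0 := by
    rw [mul_assoc, hIz, ← mul_assoc, mul_assoc u, hez, mul_zero, zero_mul]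
  refine ⟨u * e * I, P, z, ?_, ?_, hJz, hz, hzz, hP, hJP, fun Z hZ => ?_⟩
  · rw [star_mul, star_mul, hI, hesa, hu.star_eq, ← hue, neg_mul, ← mul_assoc, hIu, mul_assoc, hIe,
      mul_assoc]
  · calc u * e * I * (u * e * I) = u * e * (I * u * e) * I := by simp only [mul_assoc]
      _ = u * (e * u) * (e * I) * I := by rw [hIu, mul_assoc u I e, hIe]; simp only [mul_assoc]
      _ = u * u * (e * e) * (I * I) := by rw [← hue]; simp only [mul_assoc]
      _ = z - 1 := by rw [huu, hee, hII, he]; simp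
  · have hZP := hcP Z hZ
    have hZz := hzc Z hZP
    refine ⟨?_, hZP, hZz⟩
    set J := u * e * I
    have hVP : (Z * J - J * Z) * P = 0 := by
      rw [sub_mul, mul_assoc, hJP, mul_assoc, hZP.eq, ← mul_assoc, hJP, hZ.eq, sub_self]
    have hVz : (Z * J - J * Z) * z = 0 := by
      rw [sub_mul, mul_assoc, hJz, mul_assoc, hZz.eq, ← mul_assoc, hJz, mul_zero, zero_mul,
        sub_self]
    have hPV : P * star (Z * J - J * Z) = 0 := by
      simpa [hP.star_eq] using congrArg star hVP
    have hzV : z * star (Z * J - J * Z) = 0 := by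
      simpa [hz.star_eq] using congrArg star hVz
    have hV : star (Z * J - J * Z) = 0 := by
      ext x
      exact (hker _ (DFunLike.congr_fun hPV x)).symm.trans (DFunLike.congr_fun hzV x)
    exact sub_eq_zero.1 (star_eq_zero.1 hV)

end Diagonalization

section Approximation

open scoped InnerProductSpace

theorem exists_maximal_pairwise_subset {α : Type*} {r : α → α → Prop} (hr : ∀ a b, r a b → r b a)
    (S : Set α) :
    ∃ B ⊆ S, B.Pairwise r ∧ ∀ a ∈ S, (∀ b ∈ B, r b a) → a ∈ B := by
  obtain ⟨B, hB⟩ := zorn_subset {B : Set α | B ⊆ S ∧ B.Pairwise r} fun c hc hchain =>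
    ⟨⋃₀ c, ⟨Set.sUnion_subset fun b hb => (hc hb).1,
      (Set.pairwise_sUnion hchain.directedOn).2 fun b hb => (hc hb).2⟩,
      fun b hb => Set.subset_sUnion_of_mem hb⟩
  refine ⟨B, hB.prop.1, hB.prop.2, fun a ha h => ?_⟩
  refine hB.le_of_ge ⟨Set.insert_subset ha hB.prop.1, ?_⟩ (Set.subset_insert a B)
    (Set.mem_insert a B)
  exact hB.prop.2.insert fun b hb _ => ⟨hr _ _ (h b hb), h b hb⟩

theorem isCompactOperator_tsum {E : Type*} [NormedAddCommGroup E] [NormedSpace ℝ E]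
    [CompleteSpace E] {f : ℕ → E →L[ℝ] E} (hf : Summable f) (hc : ∀ n, IsCompactOperator (f n)) :
    IsCompactOperator (∑' n, f n : E →L[ℝ] E) := by
  refine isCompactOperator_of_tendsto hf.hasSum (Eventually.of_forall fun t => ?_)
  exact (compactOperator (RingHom.id ℝ) E E).sum_mem fun n _ => hc n

variable {E : Type*} [NormedAddCommGroup E] [InnerProductSpace ℝ E] [CompleteSpace E]

/-- A bounded normal operator commuting with a complex structure `I` is a norm limit of
operators `N k` built from finitely many commuting symmetries and a partial complex structure. -/
theorem exists_symmetry_approximation {G I s : E →L[ℝ] E}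
    (hI : star I = -I) (hII : I * I = -1) (hGI : Commute G I) (hs : IsStarProjection s)
    {δ : ℝ} (hδ : 0 < δ) :
    ∃ (J z : E →L[ℝ] E) (𝓢 : ℕ → Set (E →L[ℝ] E)) (N : ℕ → E →L[ℝ] E),
      star J = -J ∧ J * J = z - 1 ∧ J * z = 0 ∧ (∀ k, 2 * z - 1 ∈ 𝓢 k) ∧
      (∀ k, 2 * s - 1 ∈ 𝓢 k) ∧ (∀ k, 𝓢 k ⊆ 𝓢 (k + 1)) ∧ (∀ k, (𝓢 k).Finite) ∧
      (∀ k, ∀ u ∈ 𝓢 k, IsSelfAdjoint u ∧ u * u = 1) ∧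
      (∀ Z, Commute Z G → Commute Z (star G) → Commute Z s → Commute Z J ∧
        ∀ k, Commute Z (N k) ∧ ∀ u ∈ 𝓢 k, Commute Z u) ∧
      (∀ k, ‖G - N k‖ ≤ δ / 2 / 2 ^ k) ∧
      ∀ k v, (∀ u ∈ 𝓢 k, ∃ c : ℝ, u v = c • v) → (∃ t : ℝ, J v = t • I v) →
        ∃ a b : ℝ, N k v = a • v + b • I v := by
  set A : E →L[ℝ] E := (2 : ℝ)⁻¹ • (G + star G) with hA
  set B : E →L[ℝ] E := (2 : ℝ)⁻¹ • (G - star G) with hB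
  have hAB : G = A + B := by
    rw [hA, hB, ← smul_add, add_add_sub_cancel, ← two_smul ℝ, smul_smul]; norm_num
  have hAsa : IsSelfAdjoint A := by
    rw [isSelfAdjoint_iff, hA, StarModule.star_smul, star_add, star_star, star_trivial, add_comm]
  have hBsk : star B = -B := by
    rw [hB, StarModule.star_smul, star_sub, star_star, star_trivial, ← smul_neg, neg_sub]
  have hcA : ∀ Z, Commute Z G → Commute Z (star G) → Commute Z A := fun Z h h' =>
    (h.add_right h').smul_right _
  have hcB : ∀ Z, Commute Z G → Commute Z (star G) → Commute Z B := fun Z h h' =>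
    (h.sub_right h').smul_right _
  have hIG' : Commute I (star G) := by
    have h : Commute (star I) (star G) := hGI.symm.star_star
    rw [hI] at h
    simpa using h.neg_left
  obtain ⟨J, P, z, hJ, hJJ, hJz, hz, hzz, hP, hJP, hJc⟩ :=
    exists_skew_polar hBsk hI hII (hcB I hGI.symm hIG').symm
  obtain ⟨u, c, M₁, hM₁, husa, huu, huc, hu⟩ := exists_signed_digits hAsa
  obtain ⟨w, d, M₂, hM₂, hwsa, hww, hwc, hw⟩ := exists_signed_digits hP
  set M : ℝ := M₁ + ‖J‖ * M₂ with hM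
  have hM0 : 0 ≤ M := by positivity
  obtain ⟨m, hm⟩ : ∃ m : ℕ, M / 2 ^ m ≤ δ / 2 := by
    obtain ⟨m, hm⟩ := pow_unbounded_of_one_lt (M / (δ / 2)) (one_lt_two (α := ℝ))
    refine ⟨m, ?_⟩
    rw [div_lt_iff₀ (by positivity)] at hm
    rw [div_le_iff₀ (by positivity)]
    linarith
  have hss : s * s = s := hs.isIdempotentElem
  have hsym : ∀ p : E →L[ℝ] E, IsSelfAdjoint p → p * p = p →
      IsSelfAdjoint (2 * p - 1) ∧ (2 * p - 1) * (2 * p - 1) = 1 := fun p hp hpp => by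
    constructor
    · rw [two_mul]
      exact (hp.add hp).sub (IsSelfAdjoint.one _)
    · rw [two_mul, mul_sub, sub_mul, mul_add, add_mul, hpp]
      simp
  refine ⟨J, z, fun k => {2 * z - 1, 2 * s - 1} ∪ (u '' Set.Iio (k + m) ∪ w '' Set.Iio (k + m)),
    fun k => ∑ j ∈ Finset.range (k + m), c j • u j + J * ∑ j ∈ Finset.range (k + m), d j • w j,
    hJ, hJJ, hJz, fun k => by simp, fun k => by simp, fun k => ?_, fun k => ?_, fun k p hp => ?_,
    fun Z hZ hZ' hZs => ?_, fun k => ?_, fun k v hv ⟨t, ht⟩ => ?_⟩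
  · have : Set.Iio (k + m) ⊆ Set.Iio (k + 1 + m) := Set.Iio_subset_Iio (by lia)
    exact Set.union_subset_union_right _
      (Set.union_subset_union (Set.image_mono this) (Set.image_mono this))
  · exact (Set.toFinite _).union
      (((Set.finite_Iio _).image _).union ((Set.finite_Iio _).image _))
  · rcases hp with (rfl | rfl) | (⟨j, -, rfl⟩ | ⟨j, -, rfl⟩)
    exacts [hsym z hz hzz, hsym s hs.isSelfAdjoint hss, ⟨husa j, huu j⟩, ⟨hwsa j, hww j⟩]
  · obtain ⟨h1, h2, h3⟩ := hJc Z (hcB Z hZ hZ')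
    have h4 : ∀ j, Commute Z (u j) := fun j => huc j Z (hcA Z hZ hZ')
    have h5 : ∀ j, Commute Z (w j) := fun j => hwc j Z h2
    have h6 : ∀ p, Commute Z p → Commute Z (2 * p - 1) := fun p hp => by
      rw [two_mul]
      exact (hp.add_right hp).sub_right (Commute.one_right Z)
    refine ⟨h1, fun k => ⟨?_, ?_⟩⟩
    · exact (Commute.sum_right _ _ _ fun j _ => (h4 j).smul_right _).add_right
        (h1.mul_right (Commute.sum_right _ _ _ fun j _ => (h5 j).smul_right _))
    · rintro p ((rfl | rfl) | (⟨j, -, rfl⟩ | ⟨j, -, rfl⟩))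
      exacts [h6 z h3, h6 s hZs, h4 j, h5 j]
  · have h1 : G - (∑ j ∈ Finset.range (k + m), c j • u j +
        J * ∑ j ∈ Finset.range (k + m), d j • w j) =
        (A - ∑ j ∈ Finset.range (k + m), c j • u j) +
          J * (P - ∑ j ∈ Finset.range (k + m), d j • w j) := by
      rw [mul_sub, hJP]
      conv_lhs => rw [hAB]
      abel
    rw [h1]
    calc _ ≤ M₁ / 2 ^ (k + m) + ‖J‖ * (M₂ / 2 ^ (k + m)) :=
          (norm_add_le _ _).trans (add_le_add (hu _) ((norm_mul_le _ _).trans (by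
            gcongr; exact hw _)))
      _ = M / 2 ^ m / 2 ^ k := by rw [hM, pow_add]; field_simp
      _ ≤ _ := by gcongr
  · have hsum : ∀ (x : ℕ → E →L[ℝ] E) (e : ℕ → ℝ),
        (∀ j ∈ Finset.range (k + m), ∃ c : ℝ, x j v = c • v) →
        ∃ a : ℝ, (∑ j ∈ Finset.range (k + m), e j • x j) v = a • v := fun x e h => by
      have h' : ∀ j, ∃ c : ℝ, j ∈ Finset.range (k + m) → x j v = c • v := fun j => by
        by_cases hj : j ∈ Finset.range (k + m)
        · obtain ⟨c, hc⟩ := h j hj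
          exact ⟨c, fun _ => hc⟩
        · exact ⟨0, fun h => absurd h hj⟩
      choose y hy using h'
      refine ⟨∑ j ∈ Finset.range (k + m), e j * y j, ?_⟩
      rw [sum_apply, Finset.sum_smul]
      refine Finset.sum_congr rfl fun j hj => ?_
      rw [smul_apply, hy j hj, smul_smul]
    obtain ⟨a, ha⟩ := hsum u c fun j hj =>
      hv _ (Or.inr (Or.inl ⟨j, Finset.mem_range.1 hj, rfl⟩))
    obtain ⟨b, hb⟩ := hsum w d fun j hj =>
      hv _ (Or.inr (Or.inr ⟨j, Finset.mem_range.1 hj, rfl⟩))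
    refine ⟨a, b * t, ?_⟩
    rw [add_apply, ha, mul_apply_eq_comp, hb, map_smul, ht, smul_smul]

end Approximation

section Berg

open scoped InnerProductSpace

variable {E : Type*} [NormedAddCommGroup E] [InnerProductSpace ℝ E] [CompleteSpace E]

/-- The quaternion unit `i`. -/
def quatI : ℍ[ℝ] := ⟨0, 1, 0, 0⟩

theorem star_quatI : star quatI = -quatI :=
  Quaternion.star_eq_neg.2 rfl

theorem quatI_mul_self : quatI * quatI = -1 := by
  have hre : quatI.re = 0 := rfl
  have hi : quatI.imI = 1 := rfl
  have hj : quatI.imJ = 0 := rfl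
  have hk : quatI.imK = 0 := rfl
  ext <;> simp [hre, hi, hj, hk]

/-- The right multiplication by the quaternion unit `i`. -/
def complexStructure (ρ : (ℍ[ℝ])ᵐᵒᵖ →⋆ₐ[ℝ] (E →L[ℝ] E)) : E →L[ℝ] E :=
  ρ (MulOpposite.op quatI)

theorem star_complexStructure (ρ : (ℍ[ℝ])ᵐᵒᵖ →⋆ₐ[ℝ] (E →L[ℝ] E)) :
    star (complexStructure ρ) = -complexStructure ρ := by
  rw [complexStructure, ← map_star, ← map_neg, ← MulOpposite.op_star, star_quatI,
    MulOpposite.op_neg]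

theorem complexStructure_mul_self (ρ : (ℍ[ℝ])ᵐᵒᵖ →⋆ₐ[ℝ] (E →L[ℝ] E)) :
    complexStructure ρ * complexStructure ρ = -1 := by
  rw [complexStructure, ← map_mul, ← MulOpposite.op_mul, quatI_mul_self, MulOpposite.op_neg,
    MulOpposite.op_one, map_neg, map_one]

theorem inner_map_star (ρ : (ℍ[ℝ])ᵐᵒᵖ →⋆ₐ[ℝ] (E →L[ℝ] E)) (q : (ℍ[ℝ])ᵐᵒᵖ) (x y : E) :
    ⟪ρ q x, y⟫_ℝ = ⟪x, ρ (star q) y⟫_ℝ := by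
  rw [map_star]
  exact (ContinuousLinearMap.adjoint_inner_right (ρ q) x y).symm

/-- Quaternionic orthogonality of two vectors. -/
def QOrth (ρ : (ℍ[ℝ])ᵐᵒᵖ →⋆ₐ[ℝ] (E →L[ℝ] E)) (x y : E) : Prop := ∀ q, ⟪ρ q x, y⟫_ℝ = 0

theorem QOrth.symm {ρ : (ℍ[ℝ])ᵐᵒᵖ →⋆ₐ[ℝ] (E →L[ℝ] E)} {x y : E} (h : QOrth ρ x y) :
    QOrth ρ y x := fun q => by
  rw [inner_map_star, real_inner_comm, h]

/-- A compatible family of blocks reducing the operators of a filtration is used to perturb a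
normal operator into one with a total family of quaternionic eigenvectors. -/
theorem exists_compact_diagonalizing [TopologicalSpace.SeparableSpace E]
    (ρ : (ℍ[ℝ])ᵐᵒᵖ →⋆ₐ[ℝ] (E →L[ℝ] E)) {G s : E →L[ℝ] E} (hG : Commute G (star G))
    (hGρ : ∀ q, Commute G (ρ q)) (hs : IsStarProjection s) (hsG : Commute s G)
    (hsρ : ∀ q, Commute s (ρ q)) {δ : ℝ} (hδ : 0 < δ) :
    ∃ K : E →L[ℝ] E, IsCompactOperator K ∧ ‖K‖ ≤ δ ∧ (∀ q, Commute K (ρ q)) ∧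
      ∃ 𝓑 : Set E, (∀ b ∈ 𝓑, ‖b‖ = 1 ∧ s b = b ∧ ∃ q, G b - K b = ρ q b) ∧
        𝓑.Pairwise (QOrth ρ) ∧ ∀ x, s x = x → (∀ b ∈ 𝓑, QOrth ρ b x) → x = 0 := by
  set I := complexStructure ρ with hIdef
  have hI := star_complexStructure ρ
  have hII := complexStructure_mul_self ρ
  obtain ⟨J, z, 𝓢, N, hJ, hJJ, hJz, hz𝓢, hs𝓢, hmono, hfin, hsym, hcent, hGN, hNev⟩ :=
    exists_symmetry_approximation hI hII (hGρ _) hs hδ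
  have hG's : Commute s (star G) := by
    simpa [hs.isSelfAdjoint.star_eq] using hsG.star_star
  have hG'ρ : ∀ q, Commute (star G) (ρ q) := fun q => by
    simpa [← map_star] using (hGρ (star q)).star_star
  have hcρ : ∀ q, Commute (ρ q) J ∧ ∀ k, Commute (ρ q) (N k) ∧ ∀ u ∈ 𝓢 k, Commute (ρ q) u :=
    fun q => hcent _ (hGρ q).symm (hG'ρ q).symm (hsρ q).symm
  have hcG := hcent G (Commute.refl G) hG hsG.symm
  have hcG' := hcent (star G) hG.symm (Commute.refl _) hG's.symm
  have hcs := hcent s hsG hG's (Commute.refl s)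
  have hcJ := hcent J hcG.1.symm hcG'.1.symm hcs.1.symm
  have hcu : ∀ k, ∀ u ∈ 𝓢 k, Commute u J ∧ ∀ l, Commute u (N l) ∧ ∀ w ∈ 𝓢 l, Commute u w :=
    fun k u hu => hcent u ((hcG.2 k).2 u hu).symm ((hcG'.2 k).2 u hu).symm
      ((hcs.2 k).2 u hu).symm
  obtain ⟨Q, hQ, hQorth, hQc, hQρ, hQL, hQtot⟩ := exists_block_projections ρ
    (fun k => insert J (𝓢 k)) (fun k => Set.insert_subset_insert (hmono k))
    (fun k => (hfin k).insert J)
    (fun k Z hZ Y hY => by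
      rcases hZ with rfl | hZ <;> rcases hY with rfl | hY
      exacts [Commute.refl _, (hcu k Y hY).1.symm, (hcu k Z hZ).1, ((hcu k Z hZ).2 k).2 Y hY])
    (fun k Z hZ => by
      rcases hZ with rfl | hZ
      · refine ⟨-1, ?_⟩
        rw [mul_assoc, hJJ, mul_sub, hJz, mul_one, zero_sub, neg_one_smul]
      · exact ⟨1, by rw [(hsym k Z hZ).2, one_mul, one_smul]⟩)
    (fun k Z hZ => by
      rcases hZ with rfl | hZ
      exacts [Or.inr hJ, Or.inl (hsym k Z hZ).1])
    (fun k Z hZ q => by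
      rcases hZ with rfl | hZ
      exacts [(hcρ q).1.symm, (((hcρ q).2 k).2 Z hZ).symm])
  have hQs : ∀ k, Commute (Q k) s := fun k => by
    have h := hQL k _ (Or.inr (hs𝓢 k))
    have h' : s = (2 : ℝ)⁻¹ • ((2 * s - 1) + 1) := by
      rw [sub_add_cancel, two_mul, ← two_smul ℝ, smul_smul]; norm_num
    rw [h']
    exact (h.add_right (Commute.one_right _)).smul_right _
  have hKn : ∀ k, ‖(G - N k) * Q k‖ ≤ δ / 2 / 2 ^ k := fun k =>
    (norm_mul_le _ _).trans
      ((mul_le_of_le_one_right (norm_nonneg _) (hQ k).norm_le).trans (hGN k))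
  have hKsum : HasSum (fun k : ℕ => δ / 2 / 2 ^ k) δ := hasSum_geometric_two' δ
  have hKs : Summable fun k => (G - N k) * Q k :=
    Summable.of_norm_bounded hKsum.summable hKn
  set K : E →L[ℝ] E := ∑' k, (G - N k) * Q k with hK
  have hKQ : ∀ k, K * Q k = (G - N k) * Q k := fun k => by
    rw [hK, ← hKs.tsum_mul_right, tsum_eq_single k, mul_assoc, (hQ k).isIdempotentElem]
    intro l hl
    rw [mul_assoc, hQorth l k hl, mul_zero]
  refine ⟨K, isCompactOperator_tsum hKs fun k => (hQc k).clm_comp (G - N k),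
    tsum_of_norm_bounded hKsum hKn, fun q => ?_, ?_⟩
  · refine (Commute.tsum_right _ fun k => ?_).symm
    exact ((hGρ q).symm.sub_right ((hcρ q).2 k).1).mul_right (hQρ k q).symm
  obtain ⟨𝓑, h𝓑, hpair, hmax⟩ := exists_maximal_pairwise_subset (r := QOrth ρ)
    (fun _ _ h => h.symm) {v | ‖v‖ = 1 ∧ s v = v ∧ ∃ k, Q k v = v ∧
      (∀ u ∈ 𝓢 k, ∃ c : ℝ, u v = c • v) ∧ ∃ t : ℝ, J v = t • I v}
  refine ⟨𝓑, fun b hb => ?_, hpair, fun x hsx hx => ?_⟩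
  · obtain ⟨hb1, hsb, k, hQb, hu, ht⟩ := h𝓑 hb
    refine ⟨hb1, hsb, ?_⟩
    obtain ⟨α, β, h⟩ := hNev k b hu ht
    have hKb : K b = G b - N k b := by
      have := DFunLike.congr_fun (hKQ k) b
      rwa [mul_apply_eq_comp, mul_apply_eq_comp, hQb] at this
    refine ⟨α • 1 + β • MulOpposite.op quatI, ?_⟩
    rw [hKb, sub_sub_cancel, h, map_add, map_smul, map_smul, map_one]
    rfl
  · by_contra hx0
    obtain ⟨k, hk⟩ : ∃ k, Q k x ≠ 0 := by
      by_contra! h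
      exact hx0 (hQtot x h)
    have hQkk : ∀ y, Q k (Q k y) = Q k y := fun y =>
      DFunLike.congr_fun (hQ k).isIdempotentElem y
    have hcomm : ∀ {X Y : E →L[ℝ] E}, Commute X Y → ∀ y, X (Y y) = Y (X y) := fun h y =>
      DFunLike.congr_fun h.eq y
    have hdich : ∀ b ∈ 𝓑, Q k b = 0 ∨ (Q k b = b ∧
        (∀ u ∈ 𝓢 k, ∃ c : ℝ, u b = c • b) ∧ ∃ t : ℝ, J b = t • I b) := fun b hb => by
      obtain ⟨-, -, l, hQb, hu, ht⟩ := h𝓑 hb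
      rcases eq_or_ne k l with rfl | hkl
      · exact Or.inr ⟨hQb, hu, ht⟩
      · left
        rw [← hQb]
        exact DFunLike.congr_fun (hQorth k l hkl) b
    let W : Submodule ℝ E :=
      { carrier := {y | Q k y = y ∧ s y = y ∧ ∀ b ∈ 𝓑, QOrth ρ b y}
        add_mem' := fun {x y} hx hy => ⟨by rw [map_add, hx.1, hy.1],
          by rw [map_add, hx.2.1, hy.2.1],
          fun b hb q => by rw [inner_add_right, hx.2.2 b hb q, hy.2.2 b hb q, add_zero]⟩
        zero_mem' := ⟨map_zero _, map_zero _, fun b _ q => inner_zero_right _⟩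
        smul_mem' := fun c x hx => ⟨by rw [map_smul, hx.1], by rw [map_smul, hx.2.1],
          fun b hb q => by rw [real_inner_smul_right, hx.2.2 b hb q, mul_zero]⟩ }
    have horth0 : ∀ b, Q k b = 0 → ∀ y, Q k y = y → QOrth ρ b y := fun b hb y hy q => by
      rw [← hy, ← (hQ k).isSelfAdjoint.inner_comm_apply, hcomm (hQρ k q), hb, map_zero,
        inner_zero_left]
    have hW : ∀ Z : E →L[ℝ] E, Commute (Q k) Z → Commute s Z →
        (∀ b ∈ 𝓑, ∀ y, Q k b = b → QOrth ρ b y → (∀ u ∈ 𝓢 k, ∃ c : ℝ, u b = c • b) →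
          (∃ t : ℝ, J b = t • I b) → QOrth ρ b (Z y)) → ∀ y ∈ W, Z y ∈ W := by
      rintro Z hQZ hsZ hZ y ⟨hy1, hy2, hy3⟩
      have h1 : Q k (Z y) = Z y := by rw [hcomm hQZ, hy1]
      refine ⟨h1, by rw [hcomm hsZ, hy2], fun b hb => ?_⟩
      rcases hdich b hb with h | ⟨h, hu, ht⟩
      exacts [horth0 b h _ h1, hZ b hb y h (hy3 b hb) hu ht]
    have hxW : Q k x ∈ W := by
      refine ⟨hQkk x, by rw [← hcomm (hQs k), hsx], fun b hb => ?_⟩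
      rcases hdich b hb with h | ⟨h, -, -⟩
      · exact horth0 b h _ (hQkk x)
      · intro q
        rw [← (hQ k).isSelfAdjoint.inner_comm_apply, hcomm (hQρ k q), h, hx b hb]
    obtain ⟨v, hvW, hv1, hvu, hvt⟩ := exists_common_eigenvector (hfin k)
      (fun u hu => (hsym k u hu).2) (fun u hu w hw => ((hcu k u hu).2 k).2 w hw) hII hJJ hJz
      (hz𝓢 k) (hcρ _).1 (fun u hu => (((hcρ _).2 k).2 u hu).symm) (fun u hu => (hcu k u hu).1)
      (W := W) (fun h => hk ((Submodule.mem_bot ℝ).1 (h ▸ hxW)))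
      (fun u hu => hW u (hQL k u (Or.inr hu)) ((hcs.2 k).2 u hu) fun b hb y _ hy hev _ q => by
        obtain ⟨c, hc⟩ := hev u hu
        rw [← (hsym k u hu).1.inner_comm_apply, ← hcomm (((hcρ q).2 k).2 u hu), hc, map_smul,
          real_inner_smul_left, hy, mul_zero])
      (hW I (hQρ k _) (hsρ _) fun b hb y _ hy _ _ q => by
        have h := hy (star (MulOpposite.op quatI) * q)
        rw [map_mul, mul_apply_eq_comp, inner_map_star, star_star] at h
        exact h)
      (hW J (hQL k J (Or.inl rfl)) hcs.1 fun b hb y _ hy _ ⟨t, ht⟩ q => by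
        have h := hy (q * MulOpposite.op quatI)
        rw [map_mul, mul_apply_eq_comp] at h
        have h2 : ⟪ρ q b, J y⟫_ℝ = ⟪star J (ρ q b), y⟫_ℝ :=
          (ContinuousLinearMap.adjoint_inner_left J _ _).symm
        rw [h2, hJ, neg_apply, ← hcomm (hcρ q).1, ht, map_smul, ← neg_smul, real_inner_smul_left]
        exact mul_eq_zero_of_right _ h)
    have hv𝓑 := hmax v ⟨hv1, hvW.2.1, k, hvW.1, hvu, hvt⟩ hvW.2.2
    have h := hvW.2.2 v hv𝓑 1
    rw [map_one, one_apply_eq_self, real_inner_self_eq_norm_sq, hv1] at h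
    norm_num at h

end Berg

section Shells

open scoped InnerProductSpace

variable {E : Type*} [NormedAddCommGroup E] [InnerProductSpace ℝ E] [CompleteSpace E]

/-- Disjointification of a sequence of commuting projections. -/
theorem exists_orthogonal_projections {𝔸 : Type*} [Ring 𝔸] [StarRing 𝔸] {g : ℕ → 𝔸}
    (hg : ∀ n, IsStarProjection (g n)) (hgg : ∀ m n, Commute (g m) (g n)) :
    ∃ r : ℕ → 𝔸, r 0 = 1 ∧ (∀ n, r (n + 1) = r n - r n * g n) ∧
      (∀ Z, (∀ n, Commute Z (g n)) → ∀ n, Commute Z (r n)) ∧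
      (∀ n, IsStarProjection (r n * g n)) ∧ ∀ m n, m ≠ n → r m * g m * (r n * g n) = 0 := by
  set r : ℕ → 𝔸 := fun n => Nat.rec 1 (fun n x => x - x * g n) n
  have hr0 : r 0 = 1 := rfl
  have hr : ∀ n, r (n + 1) = r n - r n * g n := fun n => rfl
  clear_value r
  have hc : ∀ Z, (∀ n, Commute Z (g n)) → ∀ n, Commute Z (r n) := fun Z hZ n => by
    induction n with
    | zero => rw [hr0]; exact Commute.one_right Z
    | succ n ih => rw [hr]; exact ih.sub_right (ih.mul_right (hZ n))
  have hgr : ∀ m n, Commute (g m) (r n) := fun m => hc _ (hgg m)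
  have hrp : ∀ n, IsStarProjection (r n) := fun n => by
    induction n with
    | zero => rw [hr0]; exact IsStarProjection.one _
    | succ n ih =>
      rw [hr, ← mul_one_sub]
      exact ih.mul (hg n).one_sub ((Commute.one_right _).sub_right (hgr n n).symm)
  have hrg : ∀ m n, n < m → r m * g n = 0 := fun m n h => by
    induction m, h using Nat.le_induction with
    | base => rw [hr, sub_mul, mul_assoc, (hg n).isIdempotentElem, sub_self]
    | succ m hm ih => rw [hr, sub_mul, mul_assoc, (hgg m n).eq, ← mul_assoc, ih]; simp
  have hlt : ∀ m n, n < m → r m * g m * (r n * g n) = 0 := fun m n h => by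
    rw [← (hgr n n).eq, ← mul_assoc, mul_assoc (r m), (hgg m n).eq, ← mul_assoc, hrg m n h]
    simp
  have hsp : ∀ n, IsStarProjection (r n * g n) := fun n => (hrp n).mul (hg n) (hgr n n).symm
  refine ⟨r, hr0, hr, hc, hsp, fun m n hmn => ?_⟩
  rcases lt_or_gt_of_ne hmn with h | h
  · simpa [(hsp m).isSelfAdjoint.star_eq, (hsp n).isSelfAdjoint.star_eq, -star_mul,
      star_mul (r m * g m), star_mul (r n * g n)] using congrArg star (hlt n m h)
  · exact hlt m n h

/-- A spectral projection of a self-adjoint operator at a level `a > 0`, together with an inverse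
on the range of this projection. -/
theorem exists_level_projection {R : E →L[ℝ] E} (hR : IsSelfAdjoint R) {a : ℝ} (ha : 0 < a) :
    ∃ g V : E →L[ℝ] E, IsStarProjection g ∧ (∀ Z, Commute Z R → Commute Z g ∧ Commute Z V) ∧
      (∀ x, g x = 0 → ⟪R x, x⟫_ℝ ≤ a * ‖x‖ ^ 2) ∧ R * V * g = g := by
  obtain ⟨u, P, hu, huu, hP, hpos, -, hXu, -, huc⟩ :=
    exists_sign (hR.sub ((IsSelfAdjoint.all a).smul (IsSelfAdjoint.one (E →L[ℝ] E))))
  set g : E →L[ℝ] E := (2 : ℝ)⁻¹ • (1 + u) with hg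
  have hgu : u = 2 • g - 1 := by
    rw [hg, ← Nat.cast_smul_eq_nsmul ℝ, smul_smul]; norm_num
  have hgsa : IsSelfAdjoint g := (IsSelfAdjoint.all _).smul ((IsSelfAdjoint.one _).add hu)
  have hug : u * g = g := by
    rw [hg, mul_smul_comm, mul_add, huu, mul_one, add_comm]
  have hgg : g * g = g := by
    nth_rewrite 1 [hg]
    rw [smul_mul_assoc, add_mul, hug, one_mul, ← two_smul ℝ, smul_smul]; norm_num
  have hcg : ∀ Z, Commute Z R → Commute Z g := fun Z hZ =>
    ((Commute.one_right Z).add_right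
      (huc Z (hZ.sub_right ((Commute.one_right Z).smul_right a)))).smul_right _
  have hRg : R * g = g * R := (hcg R (Commute.refl R)).eq
  have hX : ∀ x, ⟪R (u x), x⟫_ℝ - a * ⟪u x, x⟫_ℝ = ⟪P x, x⟫_ℝ := fun x => by
    rw [← hXu, ← real_inner_smul_left, ← inner_sub_left]; rfl
  have hlow : ∀ x, g x = x → a * ‖x‖ ^ 2 ≤ ⟪R x, x⟫_ℝ := fun x hx => by
    have h := hX x
    have hux : u x = x := by
      rw [← hx]; exact DFunLike.congr_fun hug x
    rw [hux, real_inner_self_eq_norm_sq] at h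
    linarith [hpos x]
  have hgy : ∀ x, g (g x) = g x := fun x => DFunLike.congr_fun hgg x
  set Y : E →L[ℝ] E := R * g + (1 - g) with hY
  have hcoer : ∀ x, ‖x‖ ^ 2 * min a 1 ≤ ‖⟪Y x, x⟫_ℝ‖ := fun x => by
    have h1 : ⟪Y x, x⟫_ℝ = ⟪R (g x), g x⟫_ℝ + ‖x - g x‖ ^ 2 := by
      have h2 : Y x = g (R (g x)) + (x - g x) := by
        have h3 : R (g (g x)) = g (R (g x)) := DFunLike.congr_fun hRg (g x)
        rw [← h3, hgy]; rfl
      rw [h2, inner_add_left, hgsa.inner_comm_apply, ← real_inner_self_eq_norm_sq,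
        inner_sub_right (x - g x), inner_sub_left x (g x) (g x), hgsa.inner_comm_apply x (g x),
        hgy]
      ring
    have h4 : ‖x‖ ^ 2 = ‖g x‖ ^ 2 + ‖x - g x‖ ^ 2 := by
      simp only [← real_inner_self_eq_norm_sq]
      have h5 : ⟪g x, g x⟫_ℝ = ⟪x, g x⟫_ℝ := by rw [hgsa.inner_comm_apply, hgy]
      have h6 : ⟪g x, x⟫_ℝ = ⟪x, g x⟫_ℝ := hgsa.inner_comm_apply x x
      rw [inner_sub_left, inner_sub_right, inner_sub_right, h5, h6]
      ring
    refine le_trans ?_ (le_abs_self _)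
    rw [h1, h4]
    have h7 := hlow _ (hgy x)
    nlinarith [sq_nonneg ‖g x‖, sq_nonneg ‖x - g x‖, min_le_left a 1, min_le_right a 1]
  obtain ⟨v, hv⟩ : IsUnit Y := ContinuousLinearMap.isUnit_of_forall_le_norm_inner_map Y
    (c := ⟨min a 1, by positivity⟩) (lt_min ha one_pos) hcoer
  have hcV : ∀ Z, Commute Z R → Commute Z (↑v⁻¹ : E →L[ℝ] E) := fun Z hZ => by
    refine Commute.units_inv_right ?_
    rw [hv]
    exact (hZ.mul_right (hcg Z hZ)).add_right ((Commute.one_right Z).sub_right (hcg Z hZ))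
  refine ⟨g, ↑v⁻¹, ⟨hgg, hgsa⟩, fun Z hZ => ⟨hcg Z hZ, hcV Z hZ⟩, fun x hx => ?_, ?_⟩
  · have h := hX x
    have hux : u x = -x := by
      rw [hgu]
      change 2 • g x - x = -x
      rw [hx, smul_zero, zero_sub]
    rw [hux, map_neg, inner_neg_left, inner_neg_left, real_inner_self_eq_norm_sq] at h
    linarith [hpos x]
  · have hYg : Y * g = R * g := by
      rw [hY, add_mul, mul_assoc, hgg, sub_mul, hgg, one_mul, sub_self, add_zero]
    rw [(hcV R (Commute.refl R)).eq, mul_assoc, ← hYg, ← hv, Units.inv_mul_cancel_left]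

/-- An injective positive contraction `R` has an exhausting sequence of mutually orthogonal
projections in its bicommutant on the ranges of which it is invertible. -/
theorem exists_shells {R : E →L[ℝ] E} (hR : IsSelfAdjoint R)
    (hle : ∀ x, ‖R x‖ ^ 2 ≤ ⟪R x, x⟫_ℝ) (hinj : ∀ x, R x = 0 → x = 0) :
    ∃ s V : ℕ → E →L[ℝ] E, (∀ n, IsStarProjection (s n)) ∧ (∀ m n, m ≠ n → s m * s n = 0) ∧
      (∀ Z, Commute Z R → ∀ n, Commute Z (s n) ∧ Commute Z (V n)) ∧
      (∀ n, R * V n * s n = s n) ∧ ∀ x, (∀ n, s n x = 0) → x = 0 := by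
  choose g V hg hc hgle hRV using fun n : ℕ =>
    exists_level_projection hR (a := 1 / ((n : ℝ) + 1)) (by positivity)
  obtain ⟨r, hr0, hr, hrc, hsp, horth⟩ := exists_orthogonal_projections hg fun m n =>
    (hc n _ (hc m R (Commute.refl R)).1.symm).1
  have hrg : ∀ n, r n * g n = g n * r n := fun n =>
    (hrc (g n) (fun m => (hc m _ (hc n R (Commute.refl R)).1.symm).1) n).symm.eq
  refine ⟨fun n => r n * g n, V, hsp, horth, fun Z hZ n =>
    ⟨(hrc Z (fun m => (hc m Z hZ).1) n).mul_right (hc n Z hZ).1, (hc n Z hZ).2⟩, fun n => ?_,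
    fun x hx => ?_⟩
  · change R * V n * (r n * g n) = r n * g n
    rw [hrg, ← mul_assoc, hRV]
  · have hrx : ∀ n, r n x = x := fun n => by
      induction n with
      | zero => rw [hr0]; rfl
      | succ n ih => rw [hr, sub_apply, hx, ih, sub_zero]
    have hgx : ∀ n, g n x = 0 := fun n => by
      have h : (r n * g n) x = 0 := hx n
      rw [hrg, mul_apply_eq_comp, hrx] at h
      exact h
    have h0 : ⟪R x, x⟫_ℝ ≤ 0 := by
      have ht : Tendsto (fun n : ℕ => 1 / ((n : ℝ) + 1) * ‖x‖ ^ 2) atTop (𝓝 (0 * ‖x‖ ^ 2)) :=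
        tendsto_one_div_add_atTop_nhds_zero_nat.mul_const _
      rw [zero_mul] at ht
      exact ge_of_tendsto' ht fun n => hgle n x (hgx n)
    refine hinj x (norm_eq_zero.1 (pow_eq_zero_iff two_ne_zero |>.1 ?_))
    exact le_antisymm ((hle x).trans h0) (sq_nonneg _)

end Shells

section BoundedTransform

open scoped InnerProductSpace

variable {E : Type*} [NormedAddCommGroup E] [InnerProductSpace ℝ E] [CompleteSpace E]

/-- For a closed operator `T` with domain `D`, the bounded operators `R = (1 + T*T)⁻¹` and
`C = T (1 + T*T)⁻¹`, described through the quadratic form of `T`. -/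
theorem exists_resolvent_of_closed {D : Submodule ℝ E} {T : E → E}
    (hadd : ∀ x ∈ D, ∀ y ∈ D, T (x + y) = T x + T y)
    (hsmul : ∀ (c : ℝ), ∀ x ∈ D, T (c • x) = c • T x)
    (hclosed : IsClosed {p : E × E | p.1 ∈ D ∧ p.2 = T p.1}) :
    ∃ R C : E →L[ℝ] E, (∀ h, R h ∈ D) ∧ (∀ h, T (R h) = C h) ∧
      (∀ h, ∀ u ∈ D, ⟪h - R h, u⟫_ℝ = ⟪C h, T u⟫_ℝ) ∧
      ∀ h, ∀ x ∈ D, (∀ u ∈ D, ⟪h - x, u⟫_ℝ = ⟪T x, T u⟫_ℝ) → R h = x := by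
  let Γ : Submodule ℝ (WithLp 2 (E × E)) :=
    { carrier := {p | p.fst ∈ D ∧ p.snd = T p.fst}
      add_mem' := fun {p q} hp hq => ⟨add_mem hp.1 hq.1, by
        rw [WithLp.add_fst, hadd _ hp.1 _ hq.1, WithLp.add_snd, hp.2, hq.2]⟩
      zero_mem' := ⟨D.zero_mem, by
        have h := hsmul 0 0 D.zero_mem
        rw [zero_smul, zero_smul] at h
        exact h.symm⟩
      smul_mem' := fun c p hp => ⟨D.smul_mem c hp.1, by
        rw [WithLp.smul_fst, hsmul c _ hp.1, WithLp.smul_snd, hp.2]⟩ }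
  have hΓ : IsClosed (Γ : Set (WithLp 2 (E × E))) :=
    hclosed.preimage (WithLp.prod_continuous_ofLp 2 E E)
  have : CompleteSpace Γ := hΓ.completeSpace_coe
  let ι : E →L[ℝ] WithLp 2 (E × E) :=
    ((WithLp.prodContinuousLinearEquiv 2 ℝ E E).symm : E × E →L[ℝ] WithLp 2 (E × E)) ∘L
      ContinuousLinearMap.inl ℝ E E
  have hmem : ∀ h, Γ.starProjection (ι h) ∈ Γ := fun h => Γ.starProjection_apply_mem _
  have hform : ∀ h, ∀ u ∈ D, ⟪h - (Γ.starProjection (ι h)).fst, u⟫_ℝ =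
      ⟪(Γ.starProjection (ι h)).snd, T u⟫_ℝ := fun h u hu => by
    have h1 : WithLp.toLp 2 (u, T u) ∈ Γ := ⟨hu, rfl⟩
    have h2 := Γ.starProjection_inner_eq_zero (ι h) _ h1
    have h3 : ⟪h - (Γ.starProjection (ι h)).fst, u⟫_ℝ +
        ⟪0 - (Γ.starProjection (ι h)).snd, T u⟫_ℝ = 0 := h2
    rw [zero_sub, inner_neg_left] at h3
    linarith
  refine ⟨WithLp.fstL 2 ℝ E E ∘L Γ.starProjection ∘L ι,
    WithLp.sndL 2 ℝ E E ∘L Γ.starProjection ∘L ι, fun h => (hmem h).1, fun h => (hmem h).2.symm,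
    hform, fun h x hx hxu => ?_⟩
  change (Γ.starProjection (ι h)).fst = x
  set y := (Γ.starProjection (ι h)).fst with hy
  have hyD : y ∈ D := (hmem h).1
  have hsub : T (x - y) = T x - T y := by
    have h := hadd x hx ((-1 : ℝ) • y) (D.smul_mem _ hyD)
    rw [hsmul _ y hyD, neg_one_smul, neg_one_smul, ← sub_eq_add_neg, ← sub_eq_add_neg] at h
    exact h
  have hxy : x - y ∈ D := sub_mem hx hyD
  have h1 := hxu _ hxy
  have h2 := hform h _ hxy
  rw [(hmem h).2, ← hy] at h2
  have h3 : ⟪x - y, x - y⟫_ℝ + ⟪T (x - y), T (x - y)⟫_ℝ = 0 := by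
    have h4 : x - y = (h - y) - (h - x) := by abel
    conv_lhs => rw [h4, inner_sub_left, ← h4, h1, h2, hsub, inner_sub_left]
    ring
  have h5 : ⟪x - y, x - y⟫_ℝ = 0 := by
    linarith [real_inner_self_nonneg (x := x - y), real_inner_self_nonneg (x := T (x - y))]
  exact (sub_eq_zero.1 (inner_self_eq_zero.1 h5)).symm

/-- The bounded transform of a normal operator `T` with domain `D` and adjoint `S`. -/
theorem exists_bounded_transform {D : Submodule ℝ E} {D' : Set E} {T S : E → E}
    (hadd : ∀ x ∈ D, ∀ y ∈ D, T (x + y) = T x + T y)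
    (hsmul : ∀ (c : ℝ), ∀ x ∈ D, T (c • x) = c • T x)
    (hclosed : IsClosed {p : E × E | p.1 ∈ D ∧ p.2 = T p.1}) (hD : Dense (D : Set E))
    (hD' : ∀ y w, (∀ u ∈ D, ⟪y, T u⟫_ℝ = ⟪w, u⟫_ℝ) → y ∈ D')
    (hS : ∀ y ∈ D', ∀ u ∈ D, ⟪y, T u⟫_ℝ = ⟪S y, u⟫_ℝ)
    (hdom : ∀ x, x ∈ D ∧ T x ∈ D' ↔ x ∈ D' ∧ S x ∈ D)
    (hnormal : ∀ x, x ∈ D → T x ∈ D' → S (T x) = T (S x)) :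
    ∃ R C : E →L[ℝ] E, IsSelfAdjoint R ∧ (∀ x, ‖R x‖ ^ 2 ≤ ⟪R x, x⟫_ℝ) ∧
      (∀ x, R x = 0 → x = 0) ∧ Commute C R ∧ Commute C (star C) ∧ (∀ h, R h ∈ D) ∧
      (∀ h, T (R h) = C h) ∧
      ∀ Z : E →L[ℝ] E, (∀ x ∈ D, Z x ∈ D ∧ T (Z x) = Z (T x)) →
        (∀ x ∈ D, star Z x ∈ D ∧ T (star Z x) = star Z (T x)) → Commute Z R ∧ Commute Z C := by
  obtain ⟨R, C, hR, hTR, hform, huniq⟩ := exists_resolvent_of_closed hadd hsmul hclosed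
  have hsub : ∀ x ∈ D, ∀ y ∈ D, T (x - y) = T x - T y := fun x hx y hy => by
    have h := hadd x hx ((-1 : ℝ) • y) (D.smul_mem _ hy)
    rw [hsmul _ y hy, neg_one_smul, neg_one_smul, ← sub_eq_add_neg, ← sub_eq_add_neg] at h
    exact h
  have hext : ∀ a b : E, (∀ u ∈ D, ⟪a, u⟫_ℝ = ⟪b, u⟫_ℝ) → a = b := fun a b h =>
    hD.eq_of_inner_left (𝕜 := ℝ) h
  have hSe : ∀ y w, (∀ u ∈ D, ⟪y, T u⟫_ℝ = ⟪w, u⟫_ℝ) → S y = w := fun y w h =>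
    hext _ _ fun u hu => by rw [← hS y (hD' y w h) u hu, h u hu]
  have hform' : ∀ h, ∀ u ∈ D, ⟪C h, T u⟫_ℝ = ⟪h - R h, u⟫_ℝ := fun h u hu => (hform h u hu).symm
  have hCD' : ∀ h, C h ∈ D' := fun h => hD' _ _ (hform' h)
  have hSC : ∀ h, S (C h) = h - R h := fun h => hSe _ _ (hform' h)
  have hRsym : ∀ h k, ⟪k, R h⟫_ℝ = ⟪C k, C h⟫_ℝ + ⟪R k, R h⟫_ℝ := fun h k => by
    have := hform k _ (hR h)
    rw [inner_sub_left, hTR] at this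
    linarith
  have hRsa : IsSelfAdjoint R := by
    rw [ContinuousLinearMap.isSelfAdjoint_iff_isSymmetric]
    intro h k
    change ⟪R h, k⟫_ℝ = ⟪h, R k⟫_ℝ
    have h1 := hRsym h k
    have h2 := hRsym k h
    rw [real_inner_comm k, h1, h2, real_inner_comm (C h), real_inner_comm (R h)]
  have hRTC : ∀ x ∈ D, R (T x) = C x := fun x hx => by
    have hSw : S (C x) ∈ D := by
      rw [hSC]; exact sub_mem hx (hR x)
    obtain ⟨hwD, hTw⟩ := (hdom (C x)).2 ⟨hCD' x, hSw⟩
    refine huniq _ _ hwD fun u hu => ?_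
    rw [hS _ hTw u hu, hnormal _ hwD hTw, hSC, hsub _ hx _ (hR x), hTR]
  have hCR : Commute C R := by
    ext h
    change C (R h) = R (C h)
    rw [← hRTC _ (hR h), hTR]
  have hRD : ∀ h, R h ∈ D' ∧ S (R h) ∈ D := fun h =>
    (hdom _).1 ⟨hR h, by rw [hTR]; exact hCD' h⟩
  have hadjC : ∀ x y, ⟪star C x, y⟫_ℝ = ⟪x, C y⟫_ℝ := fun x y =>
    ContinuousLinearMap.adjoint_inner_left C y x
  have hstarC : ∀ h, star C h = S (R h) := fun h => hext _ _ fun u hu => by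
    rw [hadjC, ← hRTC u hu, ← hRsa.inner_comm_apply, hS _ (hRD h).1 u hu]
  have hstarC' : ∀ y ∈ D', star C y = R (S y) := fun y hy => hext _ _ fun u hu => by
    rw [hadjC, hRsa.inner_comm_apply, ← hS y hy _ (hR u), hTR]
  have hCC : Commute C (star C) := by
    ext h
    change C (star C h) = star C (C h)
    rw [hstarC' _ (hCD' h), hSC, map_sub, ← hTR, hstarC h, ← hstarC' _ (hRD h).1, hstarC,
      ← hnormal _ (hR _) (by rw [hTR]; exact hCD' _), hTR, hSC]
  refine ⟨R, C, hRsa, fun x => ?_, fun x hx => ?_, hCR, hCC, hR, hTR, fun Z hZ hZ' => ?_⟩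
  · have h := hRsym x x
    rw [real_inner_comm, h, real_inner_self_eq_norm_sq, real_inner_self_eq_norm_sq]
    linarith [sq_nonneg ‖C x‖]
  · have h0 : C x = 0 := by
      rw [← hTR, hx]
      simpa using hsmul 0 0 D.zero_mem
    refine hext _ _ fun u hu => ?_
    have h := hform x u hu
    rwa [hx, h0, sub_zero, inner_zero_left, ← inner_zero_left u] at h
  · have hadjZ : ∀ x y, ⟪star Z x, y⟫_ℝ = ⟪x, Z y⟫_ℝ := fun x y =>
      ContinuousLinearMap.adjoint_inner_left Z y x
    have hadjZ' : ∀ x y, ⟪Z x, y⟫_ℝ = ⟪x, star Z y⟫_ℝ := fun x y =>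
      (ContinuousLinearMap.adjoint_inner_right Z x y).symm
    have hZR : ∀ h, R (Z h) = Z (R h) := fun h => by
      refine huniq _ _ (hZ _ (hR h)).1 fun u hu => ?_
      rw [← map_sub, hadjZ', hform h _ (hZ' u hu).1, (hZ' u hu).2, ← hadjZ', (hZ _ (hR h)).2, hTR]
    constructor
    · ext h
      exact (hZR h).symm
    · ext h
      change Z (C h) = C (Z h)
      rw [← hTR, ← hTR, hZR, (hZ _ (hR h)).2]

end BoundedTransform

section QuaternionicSpace

open scoped InnerProductSpace

theorem rsmul_apply (q : Hq) (x : Hsp) (n : ℕ) : rsmul q x n = x n * q := rfl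

theorem rsmul_coe (r : ℝ) (x : Hsp) : rsmul (r : Hq) x = r • x := by
  ext1
  funext n
  rw [rsmul_apply, lp.coeFn_smul, Pi.smul_apply, Quaternion.mul_coe_eq_smul]

theorem rsmul_rsmul (p q : Hq) (x : Hsp) : rsmul p (rsmul q x) = rsmul (q * p) x := by
  rw [rsmul, rsmul, smul_smul, ← MulOpposite.op_mul]
  rfl

theorem inner_rsmul_left (q : Hq) (x y : Hsp) : ⟪rsmul q x, y⟫_ℝ = ⟪x, rsmul (star q) y⟫_ℝ := by
  rw [lp.inner_eq_tsum, lp.inner_eq_tsum]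
  refine tsum_congr fun n => ?_
  rw [rsmul_apply, rsmul_apply, Quaternion.inner_def, Quaternion.inner_def, star_mul, star_star,
    mul_assoc]

theorem norm_rsmul (q : Hq) (x : Hsp) : ‖rsmul q x‖ = ‖q‖ * ‖x‖ := by
  have h := inner_rsmul_left q x (rsmul q x)
  rw [rsmul_rsmul, Quaternion.self_mul_star, rsmul_coe, inner_smul_right,
    real_inner_self_eq_norm_sq, real_inner_self_eq_norm_sq,
    Quaternion.normSq_eq_norm_mul_self] at h
  exact (sq_eq_sq₀ (norm_nonneg _) (by positivity)).1 (by rw [h]; ring)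

/-- Right scalar multiplication as a bounded real-linear operator. -/
def rsmulL (q : Hq) : Hsp →L[ℝ] Hsp :=
  LinearMap.mkContinuous
    { toFun := rsmul q
      map_add' := fun x y => smul_add (MulOpposite.op q) x y
      map_smul' := fun r x => by
        rw [RingHom.id_apply, ← rsmul_coe, rsmul_rsmul, ← rsmul_coe, rsmul_rsmul,
          (Quaternion.coe_commutes r q)] }
    ‖q‖ fun x => (norm_rsmul q x).le

/-- Right scalar multiplication as a star representation of the opposite quaternions. -/
def rightRep : (ℍ[ℝ])ᵐᵒᵖ →⋆ₐ[ℝ] (Hsp →L[ℝ] Hsp) where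
  toFun q := rsmulL q.unop
  map_one' := by
    ext1 x
    exact one_smul (ℍ[ℝ])ᵐᵒᵖ x
  map_mul' p q := by
    ext1 x
    exact mul_smul p q x
  map_zero' := by
    ext1 x
    exact zero_smul (ℍ[ℝ])ᵐᵒᵖ x
  map_add' p q := by
    ext1 x
    exact add_smul p q x
  commutes' r := by
    ext1 x
    exact rsmul_coe r x
  map_star' q := by
    ext1 x
    refine ext_inner_right ℝ fun y => ?_
    rw [ContinuousLinearMap.star_eq_adjoint, ContinuousLinearMap.adjoint_inner_left]
    change ⟪rsmul (star q.unop) x, y⟫_ℝ = ⟪x, rsmul q.unop y⟫_ℝ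
    rw [inner_rsmul_left, star_star]

theorem rightRep_apply (q : (ℍ[ℝ])ᵐᵒᵖ) (x : Hsp) : rightRep q x = rsmul q.unop x := rfl

theorem summable_qinner (x y : Hsp) : Summable fun n => star (x n) * y n := by
  have hsq : ∀ z : Hsp, Summable fun n => ‖z n‖ ^ 2 := fun z => by
    simpa only [real_inner_self_eq_norm_sq] using lp.summable_inner (𝕜 := ℝ) z z
  refine Summable.of_norm_bounded ((hsq x).add (hsq y)) fun n => ?_
  rw [norm_mul, norm_star]
  nlinarith [sq_nonneg (‖x n‖ - ‖y n‖), sq_nonneg ‖x n‖, sq_nonneg ‖y n‖]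

theorem re_qinner (x y : Hsp) : (qinner x y).re = ⟪x, y⟫_ℝ := by
  have h := (summable_qinner x y).hasSum.mapL (innerSL ℝ (1 : Hq))
  have h1 : ∀ q : Hq, innerSL ℝ (1 : Hq) q = q.re := fun q => by
    rw [innerSL_apply_apply, Quaternion.inner_def, one_mul, Quaternion.re_star]
  have h2 : ∀ a b : Hq, (star a * b).re = ⟪a, b⟫_ℝ := fun a b => by
    rw [Quaternion.inner_def, Quaternion.re_mul, Quaternion.re_mul]
    simp
  simp only [h1, h2] at h
  exact h.unique (lp.hasSum_inner x y)

theorem qinner_rsmul_right (x y : Hsp) (q : Hq) : qinner x (rsmul q y) = qinner x y * q := by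
  rw [qinner, qinner, ← tsum_mul_right]
  exact tsum_congr fun n => (mul_assoc _ _ _).symm

theorem re_qinner_mul (x y : Hsp) (q : Hq) : (qinner x y * q).re = ⟪x, rsmul q y⟫_ℝ := by
  rw [← qinner_rsmul_right, re_qinner]

theorem Quaternion.ext_re_mul {a b : Hq} (h : ∀ q, (a * q).re = (b * q).re) : a = b := by
  have h1 := h (star (a - b))
  rw [← sub_eq_zero, ← Quaternion.re_sub, ← sub_mul, ← Quaternion.normSq_def,
    Quaternion.normSq_eq_zero, sub_eq_zero] at h1
  exact h1

theorem norm_qinner_le (x y : Hsp) : ‖qinner x y‖ ≤ ‖x‖ * ‖y‖ := by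
  rcases eq_or_ne (qinner x y) 0 with h0 | h0
  · rw [h0, norm_zero]
    positivity
  · have h1 := re_qinner_mul x y (star (qinner x y))
    have h2 := real_inner_le_norm x (rsmul (star (qinner x y)) y)
    rw [← h1, ← Quaternion.normSq_def, norm_rsmul, norm_star, Quaternion.normSq_eq_norm_mul_self]
      at h2
    exact le_of_mul_le_mul_left (by linarith) (norm_pos_iff.2 h0)

/-- The quaternionic inner product as a continuous real-linear map in its second variable. -/
def qinnerL (x : Hsp) : Hsp →L[ℝ] Hq :=
  LinearMap.mkContinuous
    { toFun := qinner x
      map_add' := fun y z => Quaternion.ext_re_mul fun q => by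
        rw [re_qinner_mul, add_mul, Quaternion.re_add, re_qinner_mul, re_qinner_mul,
          ← inner_add_right]
        exact congrArg _ (smul_add (MulOpposite.op q) y z)
      map_smul' := fun r y => by
        rw [RingHom.id_apply, ← rsmul_coe, qinner_rsmul_right, Quaternion.mul_coe_eq_smul] }
    ‖x‖ fun y => norm_qinner_le x y

theorem qinnerL_apply (x y : Hsp) : qinnerL x y = qinner x y := rfl

theorem separableSpace_Hsp : TopologicalSpace.SeparableSpace Hsp := by
  have h1 : TopologicalSpace.IsSeparable
      (⋃ n : ℕ, Set.range fun q : Hq => (lp.single 2 n q : Hsp)) :=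
    .iUnion fun n => TopologicalSpace.isSeparable_range
      (lp.isometry_single (E := fun _ : ℕ => Hq) (p := 2) n).continuous
  have h2 := (h1.span (R := ℝ)).closure
  rw [← TopologicalSpace.isSeparable_univ_iff]
  refine h2.mono fun x _ => ?_
  refine mem_closure_of_tendsto (lp.hasSum_single (by norm_num) x)
    (Eventually.of_forall fun s => ?_)
  exact Submodule.sum_mem _ fun n _ => Submodule.subset_span
    (Set.mem_iUnion.2 ⟨n, Set.mem_range_self _⟩)

theorem not_finiteDimensional_Hsp : ¬ FiniteDimensional ℝ Hsp := fun _ => by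
  have h : LinearIndependent ℝ fun n : ℕ => (lp.single 2 n (1 : Hq) : Hsp) := by
    refine Orthonormal.linearIndependent ⟨fun n => ?_, fun m n hmn => ?_⟩
    · rw [lp.norm_single (by norm_num), norm_one]
    · change ⟪(lp.single 2 m (1 : Hq) : Hsp), (lp.single 2 n (1 : Hq) : Hsp)⟫_ℝ = 0
      rw [lp.inner_single_left, lp.single_apply_ne _ _ _ hmn, inner_zero_right]
  exact not_finite_iff_infinite.2 inferInstance h.finite

/-- A pairwise quaternionically orthogonal total set of unit vectors can be enumerated into an
orthonormal basis of the quaternionic space. -/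
theorem exists_isONBasisOn {𝓑 : Set Hsp} (hnorm : ∀ b ∈ 𝓑, ‖b‖ = 1)
    (horth : 𝓑.Pairwise (QOrth rightRep))
    (htot : ∀ x, (∀ b ∈ 𝓑, QOrth rightRep b x) → x = 0) :
    ∃ e : ℕ → Hsp, (∀ r, e r ∈ 𝓑) ∧ IsONBasisOn Set.univ e := by
  have := separableSpace_Hsp
  have horth' : ∀ a ∈ 𝓑, ∀ b ∈ 𝓑, a ≠ b → ∀ p q, ⟪rsmul p a, rsmul q b⟫_ℝ = 0 :=
    fun a ha b hb hab p q => by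
      have h := horth ha hb hab (MulOpposite.op (p * star q))
      rw [rightRep_apply, MulOpposite.unop_op, ← rsmul_rsmul, inner_rsmul_left, star_star] at h
      exact h
  have hone : ∀ x : Hsp, rsmul 1 x = x := fun x => one_smul (ℍ[ℝ])ᵐᵒᵖ x
  have hcount : 𝓑.Countable := by
    refine Set.PairwiseDisjoint.countable_of_isOpen (s := fun b => Metric.ball b (1 / 2))
      (fun a ha b hb hab => ?_) (fun _ _ => Metric.isOpen_ball)
      (fun b _ => ⟨b, Metric.mem_ball_self (by norm_num)⟩)
    refine Metric.ball_disjoint_ball ?_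
    have h := horth' a ha b hb hab 1 1
    rw [hone, hone] at h
    have h1 := norm_sub_sq_real a b
    rw [h, hnorm a ha, hnorm b hb] at h1
    rw [dist_eq_norm]
    nlinarith [norm_nonneg (a - b)]
  have hinf : 𝓑.Infinite := fun hfin => by
    have : Finite 𝓑 := hfin
    let f : 𝓑 → Hq →ₗ[ℝ] Hsp := fun b =>
      { toFun := fun q => rsmul q b.1
        map_add' := fun p q => add_smul (MulOpposite.op p) (MulOpposite.op q) b.1
        map_smul' := fun r q => by
          rw [RingHom.id_apply, ← rsmul_coe, rsmul_rsmul, Quaternion.mul_coe_eq_smul] }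
    let F : Submodule ℝ Hsp := ⨆ b, LinearMap.range (f b)
    have hF : Fᗮ = ⊥ := by
      refine (Submodule.eq_bot_iff _).2 fun x hx => htot x fun b hb q => ?_
      exact hx _ (Submodule.mem_iSup_of_mem ⟨b, hb⟩ ⟨q.unop, rfl⟩)
    have hFtop : F = ⊤ := (Submodule.orthogonal_eq_bot_iff).1 hF
    refine not_finiteDimensional_Hsp ?_
    have : FiniteDimensional ℝ F := inferInstance
    rw [hFtop] at this
    exact Module.Finite.equiv (Submodule.topEquiv (R := ℝ) (M := Hsp))
  have : Infinite 𝓑 := hinf.to_subtype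
  have : Countable 𝓑 := hcount.to_subtype
  obtain ⟨φ⟩ : Nonempty (ℕ ≃ 𝓑) := nonempty_equiv_of_countable
  have hne : ∀ r s, r ≠ s → (φ r : Hsp) ≠ φ s := fun r s hrs h =>
    hrs (φ.injective (Subtype.ext h))
  have hδ : ∀ r s, qinner (φ r : Hsp) (φ s) = if r = s then 1 else 0 := fun r s => by
    split_ifs with h
    · subst h
      refine Quaternion.ext_re_mul fun q => ?_
      have hself : ∀ p : Hq, star p = -p → ⟪(φ r : Hsp), rsmul p (φ r)⟫_ℝ = 0 := fun p hp => by
        have h1 := inner_rsmul_left p (φ r) (φ r)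
        have h2 : rsmul (-p) (φ r : Hsp) = -rsmul p (φ r) :=
          neg_smul (MulOpposite.op p) (φ r : Hsp)
        rw [hp, h2, inner_neg_right, real_inner_comm] at h1
        linarith
      have h3 : rsmul q (φ r : Hsp) = q.re • (φ r : Hsp) + rsmul q.im (φ r) := by
        rw [← rsmul_coe, rsmul, rsmul, rsmul, ← add_smul, ← MulOpposite.op_add,
          Quaternion.re_add_im]
      rw [re_qinner_mul, h3, inner_add_right, hself _ (by simp), inner_smul_right,
        real_inner_self_eq_norm_sq, hnorm _ (φ r).2, one_mul]
      ring
    · refine Quaternion.ext_re_mul fun q => ?_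
      have h1 := horth' _ (φ r).2 _ (φ s).2 (hne r s h) 1 q
      rw [hone] at h1
      rw [re_qinner_mul, h1, zero_mul, Quaternion.re_zero]
  let V : ℕ → Hq →ₗᵢ[ℝ] Hsp := fun r =>
    { toFun := fun q => rsmul q (φ r)
      map_add' := fun p q => add_smul (MulOpposite.op p) (MulOpposite.op q) (φ r : Hsp)
      map_smul' := fun c q => by
        rw [RingHom.id_apply, ← rsmul_coe, rsmul_rsmul, Quaternion.mul_coe_eq_smul]
      norm_map' := fun q => by
        change ‖rsmul q (φ r : Hsp)‖ = ‖q‖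
        rw [norm_rsmul, hnorm _ (φ r).2, mul_one] }
  have hV : IsHilbertSum ℝ (fun _ : ℕ => Hq) V := by
    refine IsHilbertSum.mk (fun r s hrs p q => horth' _ (φ r).2 _ (φ s).2 (hne r s hrs) p q) ?_
    rw [top_le_iff, Submodule.topologicalClosure_eq_top_iff]
    refine (Submodule.eq_bot_iff _).2 fun x hx => htot x fun b hb q => ?_
    obtain ⟨r, hr⟩ := φ.surjective ⟨b, hb⟩
    refine hx _ (Submodule.mem_iSup_of_mem r ⟨q.unop, ?_⟩)
    change rsmul q.unop (φ r : Hsp) = rsmul q.unop b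
    rw [hr]
  refine ⟨fun r => φ r, fun r => (φ r).2, fun r => Set.mem_univ _, hδ, fun x _ => ?_⟩
  set w := hV.linearIsometryEquiv x with hw
  have hsum : HasSum (fun r => rsmul (w r) (φ r : Hsp)) x := by
    have h := hV.hasSum_linearIsometryEquiv_symm w
    rwa [hw, LinearIsometryEquiv.symm_apply_apply] at h
  have hcoef : ∀ r, qinner (φ r) x = w r := fun r => by
    have h := hsum.mapL (qinnerL (φ r))
    refine h.unique ?_
    convert hasSum_ite_eq r (w r) using 2 with s
    rw [qinnerL_apply, qinner_rsmul_right, hδ]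
    by_cases hrs : r = s
    · simp [hrs]
    · simp [hrs, Ne.symm hrs]
  simpa only [hcoef] using hsum

end QuaternionicSpace

section WeylVonNeumannBerg

open scoped InnerProductSpace

variable {E : Type*} [NormedAddCommGroup E] [InnerProductSpace ℝ E] [CompleteSpace E]

/-- The block perturbations of a sequence of normal operators, each living on one summand of an
orthogonal decomposition, add up to a single compact perturbation. -/
theorem exists_compact_diagonalizing_blocks [TopologicalSpace.SeparableSpace E]
    (ρ : (ℍ[ℝ])ᵐᵒᵖ →⋆ₐ[ℝ] (E →L[ℝ] E)) {s G : ℕ → E →L[ℝ] E} (hs : ∀ n, IsStarProjection (s n))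
    (hsorth : ∀ m n, m ≠ n → s m * s n = 0) (hsρ : ∀ n q, Commute (s n) (ρ q))
    (hstot : ∀ x, (∀ n, s n x = 0) → x = 0) (hG : ∀ n, Commute (G n) (star (G n)))
    (hGρ : ∀ n q, Commute (G n) (ρ q)) (hsG : ∀ n, Commute (s n) (G n)) {δ : ℝ} (hδ : 0 < δ) :
    ∃ K : E →L[ℝ] E, IsCompactOperator K ∧ ‖K‖ ≤ δ ∧ (∀ q, Commute K (ρ q)) ∧
      ∃ 𝓑 : Set E, (∀ b ∈ 𝓑, ‖b‖ = 1 ∧ ∃ n q, s n b = b ∧ G n b - K b = ρ q b) ∧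
        𝓑.Pairwise (QOrth ρ) ∧ ∀ x, (∀ b ∈ 𝓑, QOrth ρ b x) → x = 0 := by
  have happ : ∀ {A B : E →L[ℝ] E}, Commute A B → ∀ x, A (B x) = B (A x) := fun h x =>
    congrArg (fun Z : E →L[ℝ] E => Z x) h.eq
  have hsx : ∀ m n, m ≠ n → ∀ x, s n x = x → s m x = 0 := fun m n hmn x hx => by
    have h := congrArg (fun Z : E →L[ℝ] E => Z x) (hsorth m n hmn)
    simpa only [mul_apply_eq_comp, hx, zero_apply] using h
  have hδn : ∀ n : ℕ, 0 < δ / 2 / 2 ^ n := fun n => by positivity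
  choose A hAc hAn hAρ 𝓑 hAb hAo hAt using fun n =>
    exists_compact_diagonalizing ρ (hG n) (hGρ n) (hs n) (hsG n) (hsρ n) (hδn n)
  have hsnorm : ∀ n, ‖s n‖ ≤ 1 := fun n => (hs n).norm_le
  let f : ℕ → E →L[ℝ] E := fun n => s n * A n * s n
  have hfn : ∀ n, ‖f n‖ ≤ δ / 2 / 2 ^ n := fun n => by
    calc ‖s n * A n * s n‖ ≤ ‖s n‖ * ‖A n‖ * ‖s n‖ := norm_mul₃_le
      _ ≤ 1 * (δ / 2 / 2 ^ n) * 1 := by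
          gcongr
          · exact hsnorm n
          · exact hAn n
          · exact hsnorm n
      _ = δ / 2 / 2 ^ n := by ring
  have hgeo : HasSum (fun n : ℕ => δ / 2 / 2 ^ n) δ := hasSum_geometric_two' δ
  have hfs : Summable f := Summable.of_norm_bounded hgeo.summable hfn
  have hKs : ∀ n x, s n x = x → (∑' n, f n : E →L[ℝ] E) x = s n (A n x) := fun n x hx => by
    refine (hfs.hasSum.mapL (ContinuousLinearMap.apply ℝ E x)).unique ?_
    have h : ∀ m, m ≠ n → f m x = 0 := fun m hmn => by
      simp only [f, mul_apply_eq_comp, hsx m n hmn x hx, map_zero]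
    have h2 := hasSum_single n h
    have h3 : f n x = s n (A n x) := by simp only [f, mul_apply_eq_comp, hx]
    rwa [h3] at h2
  have hsb : ∀ n, ∀ b ∈ 𝓑 n, s n b = b := fun n b hb => (hAb n b hb).2.1
  refine ⟨∑' n, f n, ?_, tsum_of_norm_bounded hgeo hfn, fun q => ?_, ⋃ n, 𝓑 n, fun b hb => ?_,
    fun a ha b hb hab => ?_, fun x hx => hstot x fun n => ?_⟩
  · exact isCompactOperator_tsum hfs fun n => ((hAc n).clm_comp (s n)).comp_clm (s n)
  · have h : ∀ n, f n * ρ q = ρ q * f n := fun n =>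
      (((hsρ n q).mul_left (hAρ n q)).mul_left (hsρ n q)).eq
    change (∑' n, f n) * ρ q = ρ q * ∑' n, f n
    rw [← hfs.tsum_mul_right, ← hfs.tsum_mul_left]
    exact tsum_congr h
  · obtain ⟨n, hn⟩ := Set.mem_iUnion.1 hb
    obtain ⟨hb1, hb', q, hq⟩ := hAb n b hn
    refine ⟨hb1, n, q, hb', ?_⟩
    have h1 := happ (hsG n) b
    have h2 := happ (hsρ n q) b
    rw [hb'] at h1 h2
    rw [hKs n b hb', ← h1, ← map_sub, hq, h2]
  · obtain ⟨m, hm⟩ := Set.mem_iUnion.1 ha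
    obtain ⟨n, hn⟩ := Set.mem_iUnion.1 hb
    rcases eq_or_ne m n with rfl | hmn
    · exact hAo m hm hn hab
    · intro q
      rw [← hsb m a hm, ← happ (hsρ m q), (hs m).isSelfAdjoint.inner_comm_apply,
        hsx m n hmn b (hsb n b hn), inner_zero_right]
  · refine hAt n _ (congrArg (fun Z : E →L[ℝ] E => Z x) (hs n).isIdempotentElem) fun b hb q => ?_
    rw [← (hs n).isSelfAdjoint.inner_comm_apply, happ (hsρ n q), hsb n b hb]
    exact hx b (Set.mem_iUnion.2 ⟨n, hb⟩) q

/-- The bounded transform of a normal quaternionic operator commutes with the right scalar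
multiplications. -/
theorem QOp.exists_bounded_transform {T : QOp} (hlin : T.IsRightLinear)
    (hdense : T.IsDenselyDefined) (hclosed : T.IsClosedOp) (hnormal : T.IsNormal) :
    ∃ R C : Hsp →L[ℝ] Hsp, IsSelfAdjoint R ∧ (∀ x, ‖R x‖ ^ 2 ≤ ⟪R x, x⟫_ℝ) ∧
      (∀ x, R x = 0 → x = 0) ∧ Commute C R ∧ Commute C (star C) ∧ (∀ h, R h ∈ T.dom) ∧
      (∀ h, T.app (R h) = C h) ∧ ∀ q, Commute (rightRep q) R ∧ Commute (rightRep q) C := by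
  obtain ⟨h0, hadd, hmul⟩ := hlin
  obtain ⟨S, ⟨hSdom, hS⟩, hcomp, hcompval⟩ := hnormal
  let D : Submodule ℝ Hsp :=
    { carrier := T.dom
      add_mem' := fun {x y} hx hy => (hadd x hx y hy).1
      zero_mem' := h0
      smul_mem' := fun r x hx => by
        rw [← rsmul_coe]
        exact (hmul x hx r).1 }
  have hD' : ∀ y w, (∀ u ∈ D, ⟪y, T.app u⟫_ℝ = ⟪w, u⟫_ℝ) → y ∈ S.dom := fun y w h => by
    rw [hSdom]
    refine (qinnerL w).continuous.continuousOn.congr fun u hu => Quaternion.ext_re_mul fun q => ?_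
    rw [qinnerL_apply, re_qinner_mul, re_qinner_mul, ← (hmul u hu q).2, h _ (hmul u hu q).1]
  have hmem : ∀ x, (x ∈ T.dom ∧ T.app x ∈ S.dom ↔ x ∈ S.dom ∧ S.app x ∈ T.dom) := fun x =>
    Set.ext_iff.1 hcomp x
  obtain ⟨R, C, hR, hle, hinj, hCR, hCC, hRD, hTR, hcomm⟩ :=
    _root_.exists_bounded_transform (D := D) (D' := S.dom) (T := T.app) (S := S.app)
      (fun x hx y hy => (hadd x hx y hy).2)
      (fun r x hx => by rw [← rsmul_coe, ← rsmul_coe, (hmul x hx r).2])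
      hclosed hdense hD'
      (fun y hy u hu => by rw [← re_qinner, ← re_qinner, hS y hy u hu]) hmem
      (fun x hx hx' => hcompval x ⟨hx, hx'⟩)
  refine ⟨R, C, hR, hle, hinj, hCR, hCC, hRD, hTR, fun q => hcomm _ (fun x hx => hmul x hx q.unop)
    fun x hx => ?_⟩
  rw [← map_star]
  exact hmul x hx (star q).unop

/-- A normal quaternionic operator is reduced by an orthogonal decomposition of the space to
bounded normal operators. -/
theorem QOp.exists_reducing_blocks {T : QOp} (hlin : T.IsRightLinear)
    (hdense : T.IsDenselyDefined) (hclosed : T.IsClosedOp) (hnormal : T.IsNormal) :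
    ∃ s G : ℕ → Hsp →L[ℝ] Hsp, (∀ n, IsStarProjection (s n)) ∧
      (∀ m n, m ≠ n → s m * s n = 0) ∧ (∀ n q, Commute (s n) (rightRep q)) ∧
      (∀ x, (∀ n, s n x = 0) → x = 0) ∧ (∀ n, Commute (G n) (star (G n))) ∧
      (∀ n q, Commute (G n) (rightRep q)) ∧ (∀ n, Commute (s n) (G n)) ∧
      ∀ n x, s n x = x → x ∈ T.dom ∧ T.app x = G n x := by
  obtain ⟨R, C, hR, hle, hinj, hCR, hCC, hRD, hTR, hcomm⟩ :=
    QOp.exists_bounded_transform hlin hdense hclosed hnormal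
  obtain ⟨s, V, hs, hsorth, hcent, hRV, htot⟩ := exists_shells hR hle hinj
  have hstar : ∀ Z : Hsp →L[ℝ] Hsp, Commute Z R → Commute (star Z) R := fun Z hZ => by
    simpa [hR.star_eq] using hZ.star_star
  have hC := hcent C hCR
  have hC' := hcent (star C) (hstar C hCR)
  have hV : ∀ n, Commute (V n) R := fun n => ((hcent R (Commute.refl R)) n).2.symm
  have hVV : ∀ n, Commute (V n) (star (V n)) := fun n =>
    ((hcent _ (hstar _ (hV n))) n).2.symm
  have hCV' : ∀ n, Commute C (star (V n)) := fun n => by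
    simpa using ((hC' n).2).star_star
  refine ⟨s, fun n => C * V n, hs, hsorth, fun n q => ((hcent _ (hcomm q).1) n).1.symm, htot,
    fun n => ?_, fun n q => ?_, fun n => ?_, fun n x hx => ?_⟩
  · change Commute (C * V n) (star (C * V n))
    rw [star_mul]
    exact ((hCV' n).mul_right hCC).mul_left ((hVV n).mul_right ((hC' n).2.symm))
  · exact ((hcomm q).2.symm).mul_left ((hcent _ (hcomm q).1) n).2.symm
  · exact ((hC n).1.symm).mul_right ((hcent _ (hV n)) n).1.symm
  · have hx' : R (V n x) = x := by
      have h := congrArg (fun Z : Hsp →L[ℝ] Hsp => Z x) (hRV n)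
      simpa only [mul_apply_eq_comp, hx] using h
    have h1 := hRD (V n x)
    have h2 := hTR (V n x)
    rw [hx'] at h1 h2
    exact ⟨h1, h2⟩

end WeylVonNeumannBerg

/-- **Weyl–von Neumann–Berg theorem for quaternionic operators.**
Let `T ∈ C(H)` be a densely defined closed right linear normal operator in
`H = ℓ²(ℕ, ℍ)`. For every `ε > 0` there are a compact `K ∈ B(H)` with `‖K‖ < ε` and a
diagonal operator `D` with `D(D) = D(T)` such that `T = D + K` on `D(T)`. -/
theorem weyl_vonNeumann_berg_quaternionic (T : QOp)
    (hlin : T.IsRightLinear) (hdense : T.IsDenselyDefined)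
    (hclosed : T.IsClosedOp) (hnormal : T.IsNormal)
    (ε : ℝ) (hε : 0 < ε) :
    ∃ K : Hsp → Hsp, IsBoundedRightLinear K ∧ IsCompactOn K Set.univ ∧
      (∃ M : ℝ, M < ε ∧ ∀ x, ‖K x‖ ≤ M * ‖x‖) ∧
      ∃ D : QOp, D.IsRightLinear ∧ D.dom = T.dom ∧ D.IsDiagonal ∧
        ∀ x ∈ T.dom, T.app x = D.app x + K x := by
  obtain ⟨s, G, hs, hsorth, hsρ, hstot, hG, hGρ, hsG, hTG⟩ :=
    QOp.exists_reducing_blocks hlin hdense hclosed hnormal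
  have := separableSpace_Hsp
  obtain ⟨K, hKc, hKn, hKρ, 𝓑, h𝓑, horth, htot⟩ := exists_compact_diagonalizing_blocks rightRep
    hs hsorth hsρ hstot hG hGρ hsG (half_pos hε)
  obtain ⟨e, he𝓑, he⟩ := exists_isONBasisOn (fun b hb => (h𝓑 b hb).1) horth htot
  have hK : ∀ q x, K (rsmul q x) = rsmul q (K x) := fun q x =>
    congrArg (fun Z : Hsp →L[ℝ] Hsp => Z x) (hKρ (MulOpposite.op q)).eq
  have hed : ∀ r, e r ∈ T.dom ∧ ∃ q : Hq, T.app (e r) - K (e r) = rsmul q (e r) := fun r => by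
    obtain ⟨-, n, q, hn, hq⟩ := h𝓑 _ (he𝓑 r)
    obtain ⟨hd, hT⟩ := hTG n _ hn
    exact ⟨hd, q.unop, by rw [hT, hq, rightRep_apply]⟩
  choose hedom q hq using hed
  refine ⟨K, ⟨map_add K, hK, ‖K‖, K.le_opNorm⟩, ?_,
    ⟨‖K‖, hKn.trans_lt (half_lt_self hε), K.le_opNorm⟩,
    ⟨T.dom, fun x => T.app x - K x⟩, ⟨hlin.1, fun x hx y hy => ⟨(hlin.2.1 x hx y hy).1, ?_⟩,
      fun x hx p => ⟨(hlin.2.2 x hx p).1, ?_⟩⟩, rfl, ⟨e, he, hedom, q, hq⟩,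
    fun x _ => (sub_add_cancel _ _).symm⟩
  · rw [IsCompactOn, Set.inter_univ]
    exact hKc.isCompact_closure_image_closedBall 1
  · change T.app (x + y) - K (x + y) = (T.app x - K x) + (T.app y - K y)
    rw [(hlin.2.1 x hx y hy).2, map_add]
    abel
  · change T.app (rsmul p x) - K (rsmul p x) = rsmul p (T.app x - K x)
    rw [(hlin.2.2 x hx p).2, hK]
    exact (smul_sub (MulOpposite.op p) (T.app x) (K x)).symm
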